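/- Let N ≥ 2, let M be the unit sphere {z ∈ ℂ^N : |z| = 1} and fix p ∈ M. Then there exists a generic real-analytic submanifold M' ⊆ ℂ^{N+1} of codimension 1 (a real-analytic hypersurface) such that for every ℓ ≥ 2 the mapping locus E_ℓ ⊆ M' is singular: there exists a point q ∈ E_ℓ such that for no open neighborhood U of q in ℂ^{N+1} is E_ℓ ∩ U a real-analytic submanifold of ℂ^{N+1}. -/

import Mathlib

open Complex Topology

noncomputable section

/-- `ℂ^n`. -/
abbrev Cn (n : ℕ) : Type := EuclideanSpace ℂ (Fin n)

/-- `ℝ^m`. -/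
abbrev Rm (m : ℕ) : Type := EuclideanSpace ℝ (Fin m)

/-- The vector of `ℂ^n` with entry `c` in the `j`-th coordinate and `0` elsewhere. -/
def cbasis {n : ℕ} (j : Fin n) (c : ℂ) : Cn n := EuclideanSpace.single j c

/-- The `j`-th component of the Wirtinger gradient `∂f(q)` of a real-valued function `f`. -/
def wirtD {n : ℕ} (f : Cn n → ℝ) (q : Cn n) : Fin n → ℂ := fun j =>
  (1 / 2 : ℂ) * ((fderiv ℝ f q (cbasis j 1) : ℂ)
    - Complex.I * (fderiv ℝ f q (cbasis j Complex.I) : ℂ))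

/-- The `j`-th component of `∂̄g(q)` for a complex-valued function `g`. -/
def wirtDBar {n : ℕ} (g : Cn n → ℂ) (q : Cn n) : Fin n → ℂ := fun j =>
  (1 / 2 : ℂ) * (fderiv ℝ g q (cbasis j 1) + Complex.I * fderiv ℝ g q (cbasis j Complex.I))

/-- The `j`-th component of `∂̄f(q)` for a real-valued function `f`. -/
def wirtDBarR {n : ℕ} (f : Cn n → ℝ) (q : Cn n) : Fin n → ℂ := fun j =>
  (1 / 2 : ℂ) * ((fderiv ℝ f q (cbasis j 1) : ℂ)
    + Complex.I * (fderiv ℝ f q (cbasis j Complex.I) : ℂ))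

/-- `M` is a generic real-analytic submanifold of codimension `d` near `p`. -/
def IsGenericAt {n : ℕ} (M : Set (Cn n)) (d : ℕ) (p : Cn n) : Prop :=
  p ∈ M ∧ ∃ (U : Set (Cn n)) (ρ : Cn n → Fin d → ℝ),
    IsOpen U ∧ p ∈ U ∧ (∀ k, AnalyticOnNhd ℝ (fun z => ρ z k) U) ∧
    (M ∩ U = {z | z ∈ U ∧ ∀ k, ρ z k = 0}) ∧
    ∀ q ∈ M ∩ U, LinearIndependent ℂ (fun k : Fin d => wirtD (fun z => ρ z k) q)

/-- `S` is, near its point `q`, a real-analytic submanifold of (real) dimension `mdim`. -/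
def IsRASubmanifoldAt {E : Type*} [NormedAddCommGroup E] [NormedSpace ℝ E]
    (S : Set E) (q : E) (mdim : ℕ) : Prop :=
  ∃ (c : ℕ) (U : Set E) (ρ : E → Fin c → ℝ),
    IsOpen U ∧ q ∈ U ∧ mdim + c = Module.finrank ℝ E ∧
    (∀ k, AnalyticOnNhd ℝ (fun z => ρ z k) U) ∧
    (S ∩ U = {z | z ∈ U ∧ ∀ k, ρ z k = 0}) ∧
    ∀ x ∈ S ∩ U, LinearIndependent ℝ (fun k : Fin c => fderiv ℝ (fun z => ρ z k) x)

/-- The tangent space of a set at a point: the span of the tangent cone. -/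
def tangentSpaceAt {E : Type*} [NormedAddCommGroup E] [NormedSpace ℝ E] (S : Set E) (q : E) :
    Submodule ℝ E := Submodule.span ℝ (tangentConeAt ℝ S q)

/-- Multiplication by `i` on `ℂ^n` as an `ℝ`-linear map. -/
def mulI {n : ℕ} : Cn n →ₗ[ℝ] Cn n :=
  (LinearMap.lsmul ℂ (Cn n) Complex.I).restrictScalars ℝ

/-- `M` (a generic submanifold of codimension `d`, hence of real dimension `2n - d`) is
minimal at `p`: there is no real-analytic submanifold `S ⊆ M` through `p` of strictly
smaller dimension whose tangent spaces contain the complex tangent spaces of `M`. -/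
def IsMinimalAt {n : ℕ} (M : Set (Cn n)) (d : ℕ) (p : Cn n) : Prop :=
  ¬ ∃ (S : Set (Cn n)) (mdim : ℕ), S ⊆ M ∧ p ∈ S ∧ mdim < 2 * n - d ∧
      (∀ q ∈ S, IsRASubmanifoldAt S q mdim) ∧
      ∀ q ∈ S, tangentSpaceAt M q ⊓ (tangentSpaceAt M q).map mulI ≤ tangentSpaceAt S q

/-- A real-analytic CR vector field of `M` near `p`. -/
structure CRVectorField {N : ℕ} (M : Set (Cn N)) (p : Cn N) where
  coeff : Cn N → Fin N → ℂ
  dom : Set (Cn N)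
  isOpen : IsOpen dom
  mem : p ∈ dom
  analytic : ∀ j, AnalyticOnNhd ℝ (fun z => coeff z j) dom
  tangent : ∀ (f : Cn N → ℝ) (U : Set (Cn N)), IsOpen U → p ∈ U → AnalyticOnNhd ℝ f U →
    (∀ z ∈ M ∩ U, f z = 0) →
    ∃ V, IsOpen V ∧ p ∈ V ∧ ∀ z ∈ M ∩ V, (∑ j, coeff z j * wirtDBarR f z j) = 0

/-- Application of a CR vector field to a complex-valued function. -/
def CRVectorField.apply {N : ℕ} {M : Set (Cn N)} {p : Cn N} (L : CRVectorField M p)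
    (g : Cn N → ℂ) : Cn N → ℂ := fun z => ∑ j, L.coeff z j * wirtDBar g z j

/-- Iterated application `L̄₁ ⋯ L̄ₖ g` of a list of CR vector fields. -/
def CRApplyList {N : ℕ} {M : Set (Cn N)} {p : Cn N} (Ls : List (CRVectorField M p))
    (g : Cn N → ℂ) : Cn N → ℂ := Ls.foldr CRVectorField.apply g

/-- `H` is finitely nondegenerate of order at most `ℓ` at `p` (as a map of `M` into `M'`). -/
def FinNondeg {N N' : ℕ} (M : Set (Cn N)) (p : Cn N) (M' : Set (Cn N')) (ℓ : ℕ)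
    (H : Cn N → Cn N') : Prop :=
  Submodule.span ℂ
    { v : Fin N' → ℂ | ∃ (Ls : List (CRVectorField M p)) (ρ' : Cn N' → ℝ) (U' : Set (Cn N')),
        Ls.length ≤ ℓ ∧ IsOpen U' ∧ H p ∈ U' ∧ AnalyticOnNhd ℝ ρ' U' ∧
        (∀ w ∈ M' ∩ U', ρ' w = 0) ∧
        v = fun j => CRApplyList Ls (fun z => wirtD ρ' (H z) j) p } = ⊤

/-- The mapping locus `E_ℓ ⊆ M'`. -/
def MappingLocus {N N' : ℕ} (M : Set (Cn N)) (p : Cn N) (M' : Set (Cn N')) (ℓ : ℕ) :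
    Set (Cn N') :=
  { p' | p' ∈ M' ∧ ∃ (Ω : Set (Cn N)) (H : Cn N → Cn N'),
      IsOpen Ω ∧ p ∈ Ω ∧ DifferentiableOn ℂ H Ω ∧ H p = p' ∧
      (∀ z ∈ M ∩ Ω, H z ∈ M') ∧ FinNondeg M p M' ℓ H }

/-- A semi-analytic subset of a real vector space. -/
def SemiAnalyticSet {E : Type*} [NormedAddCommGroup E] [NormedSpace ℝ E] (A : Set E) : Prop :=
  ∀ x : E, ∃ U : Set E, IsOpen U ∧ x ∈ U ∧
    ∃ (n k : ℕ) (f : Fin n → Fin k → E → ℝ) (iseq : Fin n → Fin k → Bool),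
      (∀ i j, AnalyticOnNhd ℝ (f i j) U) ∧
      A ∩ U = ⋃ i, ⋂ j, {x | x ∈ U ∧ if iseq i j then f i j x = 0 else 0 < f i j x}

/-- `A` is locally semi-analytic along `M'`. -/
def LocallySemiAnalyticOn {E : Type*} [NormedAddCommGroup E] [NormedSpace ℝ E]
    (M' A : Set E) : Prop :=
  ∀ q ∈ M', ∃ U : Set E, IsOpen U ∧ q ∈ U ∧ SemiAnalyticSet (A ∩ U)


/-- `S` is a real-analytic submanifold (near each of its points, of some dimension). -/
def IsRASubmanifold {E : Type*} [NormedAddCommGroup E] [NormedSpace ℝ E] (S : Set E) : Prop :=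
  ∀ q ∈ S, ∃ mdim : ℕ, IsRASubmanifoldAt S q mdim


/- part Alg -/
section
lemma alg_indep_card_le {S : Type} [Fintype S] (β : S → ℝ) (hβ : AlgebraicIndependent ℚ β)
    (s : Set ℝ) (hs : s.Finite)
    (h : ∀ μ, β μ ∈ IntermediateField.adjoin ℚ s) : Fintype.card S ≤ s.ncard := by
  set Mt := AlgebraicIndependent.matroid ℚ ℝ
  have hind : Mt.Indep (Set.range β) := by
    rw [AlgebraicIndependent.matroid_indep_iff]
    exact hβ.coe_range
  have hcl : ∀ x ∈ IntermediateField.adjoin ℚ s, x ∈ Mt.closure s := by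
    intro x hx
    rw [AlgebraicIndependent.matroid_closure_eq]
    rw [SetLike.mem_coe]
    induction hx using IntermediateField.adjoin_induction with
    | mem x hx =>
      exact isAlgebraic_algebraMap (⟨x, Algebra.subset_adjoin hx⟩ : Algebra.adjoin ℚ s)
    | algebraMap x =>
      exact isAlgebraic_algebraMap (algebraMap ℚ (Algebra.adjoin ℚ s) x)
    | add x y _ _ h1 h2 => exact add_mem h1 h2
    | inv x _ h1 => exact IsAlgebraic.inv h1
    | mul x y _ _ h1 h2 => exact mul_mem h1 h2
  have h1 : (Set.range β).encard ≤ s.encard := by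
    calc (Set.range β).encard ≤ Mt.eRk (Mt.closure s) := by
          apply hind.encard_le_eRk_of_subset
          rintro _ ⟨μ, rfl⟩
          exact hcl _ (h μ)
      _ = Mt.eRk s := Mt.eRk_closure_eq s
      _ ≤ s.encard := Mt.eRk_le_encard s
  rw [← hs.cast_ncard_eq, ← (Set.finite_range β).cast_ncard_eq] at h1
  have h2 : (Set.range β).ncard = Fintype.card S := by
    rw [← Set.image_univ, Set.ncard_image_of_injective _ hβ.injective, Set.ncard_univ, Nat.card_eq_fintype_card]
  rw [h2] at h1
  exact_mod_cast h1

set_option maxHeartbeats 2000000 in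
/-- Key linear algebra fact. -/
lemma lemmaA {S : Type} [Fintype S] [DecidableEq S] (β : S → ℝ) (hβ : AlgebraicIndependent ℚ β)
    (J : Set ℝ) (hJ : J.Finite) (n : ℕ) (hn : J.ncard ≤ n) :
    Module.finrank ℝ (Submodule.span ℝ {a : S → ℝ | (∀ μ, a μ ∈ IntermediateField.adjoin ℚ J) ∧
      ∑ μ, a μ * β μ ∈ IntermediateField.adjoin ℚ J}) ≤ n := by
  classical
  set K := IntermediateField.adjoin ℚ J with hK
  let V := ℝ ⧸ (Submodule.span K {(1:ℝ)})
  let v : S → V := fun μ => Submodule.Quotient.mk (β μ)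
  let T : (S → K) →ₗ[K] V := Fintype.linearCombination K v
  obtain ⟨κ, a, ha, hspan, hli⟩ := exists_linearIndependent' K v
  have : Finite κ := Finite.of_injective a ha
  have : Fintype κ := Fintype.ofFinite κ
  -- dimension count
  have hrange : LinearMap.range T = Submodule.span K (Set.range v) := by
    simp [T, Fintype.range_linearCombination]
  have hcard : Module.finrank K (LinearMap.range T) = Fintype.card κ := by
    rw [hrange, ← hspan, finrank_span_eq_card hli]
  have hrn := LinearMap.finrank_range_add_finrank_ker T
  rw [hcard, Module.finrank_fintype_fun_eq_card] at hrn
  have hbig : Fintype.card S ≤ n + Fintype.card κ := by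
    have h1 := alg_indep_card_le β hβ (J ∪ Set.range (β ∘ a)) (hJ.union (Set.finite_range _)) (by
      intro μ
      set F := IntermediateField.adjoin ℚ (J ∪ Set.range (β ∘ a)) with hF
      have hKF : K ≤ F := IntermediateField.adjoin.mono _ _ _ Set.subset_union_left
      have h1 : v μ ∈ Submodule.span K (Set.range (v ∘ a)) := by
        rw [hspan]; exact Submodule.subset_span ⟨μ, rfl⟩
      rw [Submodule.mem_span_range_iff_exists_fun] at h1
      obtain ⟨c, hc⟩ := h1
      have h2 : β μ - ∑ i, c i • β (a i) ∈ Submodule.span K {(1:ℝ)} := by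
        rw [← Submodule.Quotient.mk_eq_zero]
        have := sub_eq_zero.mpr hc.symm
        rw [← this]
        change (Submodule.mkQ _) _ = _
        rw [map_sub, map_sum]
        simp only [map_smul]
        rfl
      rw [Submodule.mem_span_singleton] at h2
      obtain ⟨k, hk⟩ := h2
      have h3 : β μ = k • (1:ℝ) + ∑ i, c i • β (a i) := by rw [hk]; ring
      rw [h3]
      apply add_mem
      · rw [Algebra.smul_def, mul_one]; exact hKF k.2
      · apply sum_mem
        intro i _
        rw [Algebra.smul_def]
        apply mul_mem (hKF (c i).2)
        exact IntermediateField.subset_adjoin _ _ (Or.inr ⟨i, rfl⟩))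
    refine h1.trans ((Set.ncard_union_le _ _).trans ?_)
    refine add_le_add hn ?_
    rw [← Set.image_univ]
    refine (Set.ncard_image_le Set.finite_univ).trans ?_
    rw [Set.ncard_univ, Nat.card_eq_fintype_card]
  have hd : Module.finrank K (LinearMap.ker T) ≤ n := by omega
  let bas := Module.finBasis K (LinearMap.ker T)
  let emb : (S → K) → (S → ℝ) := fun c μ => (c μ : ℝ)
  have hsub : Submodule.span ℝ {a : S → ℝ | (∀ μ, a μ ∈ K) ∧ ∑ μ, a μ * β μ ∈ K} ≤
      Submodule.span ℝ (Set.range (fun i => emb (bas i : S → K))) := by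
    rw [Submodule.span_le]
    rintro x ⟨hx1, hx2⟩
    let c : S → K := fun μ => ⟨x μ, hx1 μ⟩
    have hc : c ∈ LinearMap.ker T := by
      rw [LinearMap.mem_ker]
      simp only [T, Fintype.linearCombination_apply, v]
      have : (∑ i, c i • (Submodule.Quotient.mk (β i) : V)) = (Submodule.mkQ (Submodule.span K {(1:ℝ)})) (∑ i, c i • β i) := by
        rw [map_sum]; simp only [map_smul]; rfl
      rw [this, Submodule.mkQ_apply, Submodule.Quotient.mk_eq_zero, Submodule.mem_span_singleton]
      refine ⟨⟨_, hx2⟩, ?_⟩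
      rw [Algebra.smul_def, mul_one]
      rfl
    have hrep := bas.sum_repr ⟨c, hc⟩
    have hx : x = ∑ i, ((bas.repr ⟨c, hc⟩ i : K) : ℝ) • emb (bas i : S → K) := by
      funext μ
      have := congrArg (fun q : LinearMap.ker T => (((q : S → K) μ : K) : ℝ)) hrep
      simp only [Submodule.coe_sum, Finset.sum_apply, Submodule.coe_smul, Pi.smul_apply] at this
      rw [Finset.sum_apply]
      simp only [Pi.smul_apply, emb, smul_eq_mul]
      rw [show x μ = ((c μ : K) : ℝ) from rfl, ← this]
      push_cast
      simp [smul_eq_mul]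
    rw [hx]
    exact Submodule.sum_mem _ fun i _ => Submodule.smul_mem _ _ (Submodule.subset_span ⟨i, rfl⟩)
  calc _ ≤ Module.finrank ℝ (Submodule.span ℝ (Set.range (fun i => emb (bas i : S → K)))) :=
        Submodule.finrank_mono hsub
    _ ≤ Fintype.card (Fin (Module.finrank K (LinearMap.ker T))) := finrank_range_le_card _
    _ ≤ n := by simpa using hd

lemma exists_alg_indep (S : Type) [Finite S] : ∃ β : S → ℝ, AlgebraicIndependent ℚ β := by
  obtain ⟨s, hs⟩ := exists_isTranscendenceBasis ℚ ℝ
  have hinf : Infinite s := by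
    by_contra hfin
    rw [not_infinite_iff_finite] at hfin
    have halg := hs.isAlgebraic
    have h1 := Algebra.IsAlgebraic.cardinalMk_le_max (Algebra.adjoin ℚ (Set.range ((↑) : s → ℝ))) ℝ
    have h2 : Cardinal.mk (Algebra.adjoin ℚ (Set.range ((↑) : s → ℝ))) ≤ Cardinal.aleph0 := by
      have := Algebra.lift_cardinalMk_adjoin_le ℚ (Set.range ((↑) : s → ℝ))
      simp at this
      simpa using this
    have h3 : Cardinal.mk ℝ ≤ Cardinal.aleph0 := h1.trans (max_le h2 le_rfl)
    rw [Cardinal.mk_real] at h3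
    exact absurd Cardinal.aleph0_lt_continuum (not_lt.mpr h3)
  have := Fintype.ofFinite S
  obtain ⟨f⟩ : Nonempty (S ↪ s) := by
    obtain ⟨t, ht⟩ := Infinite.exists_subset_card_eq s (Fintype.card S)
    let e := Fintype.equivOfCardEq (α := S) (β := t) (by simp [ht])
    exact ⟨e.toEmbedding.trans (Function.Embedding.subtype _)⟩
  exact ⟨_, hs.1.comp f f.injective⟩
end

/- part Jets -/
section
open Asymptotics Filter Topology in
lemma poly_lowest {ι : Type} [Fintype ι] (Q : MvPolynomial ι ℝ) (m : ℕ)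
    (Y : (ι → ℝ) → (ι → ℝ)) (hY0 : Y 0 = 0)
    (hY : HasFDerivAt Y (ContinuousLinearMap.id ℝ (ι → ℝ)) 0)
    (h : (fun t => MvPolynomial.eval (Y t) Q) =O[𝓝 0] fun t => ‖t‖ ^ (m + 1)) :
    ∀ d : ι →₀ ℕ, d.degree ≤ m → Q.coeff d = 0 := by
  classical
  have key : ∀ k ≤ m, MvPolynomial.homogeneousComponent k Q = 0 := by
    intro k
    induction k using Nat.strong_induction_on with
    | _ k ih =>
    intro hk
    apply (MvPolynomial.homogeneousComponent_isHomogeneous k Q).eq_zero_of_forall_eval_eq_zero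
    intro v
    -- scaling
    have hscale : ∀ (ε : ℝ), ε ≠ 0 → ∀ y : ι → ℝ, ∀ j, MvPolynomial.eval y (MvPolynomial.homogeneousComponent j Q) = ε ^ j * MvPolynomial.eval (ε⁻¹ • y) (MvPolynomial.homogeneousComponent j Q) := by
      intro ε hε y j
      rw [MvPolynomial.eval_eq', MvPolynomial.eval_eq', Finset.mul_sum]
      apply Finset.sum_congr rfl
      intro d hd
      have hdeg := (MvPolynomial.homogeneousComponent_isHomogeneous j Q).degree_eq_sum_deg_support hd
      simp only [Pi.smul_apply, smul_eq_mul, mul_pow, Finset.prod_mul_distrib]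
      rw [Finset.prod_pow_eq_pow_sum]
      have : ∑ i, d i = j := by
        rw [hdeg, Finset.sum_subset (Finset.subset_univ d.support)]
        intro x _ hx; simpa using hx
      rw [this, inv_pow]
      field_simp
    have hYv : Tendsto (fun ε : ℝ => ε⁻¹ • Y (ε • v)) (𝓝[≠] 0) (𝓝 v) := by
      have h1 : HasDerivAt (fun ε : ℝ => Y (ε • v)) v 0 := by
        have h2 : HasDerivAt (fun ε : ℝ => ε • v) v 0 := by
          simpa using (hasDerivAt_id (0:ℝ)).smul_const v
        have hY' : HasFDerivAt Y (ContinuousLinearMap.id ℝ (ι → ℝ)) ((0:ℝ) • v) := by simpa using hY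
        exact hY'.comp_hasDerivAt (0:ℝ) h2
      rw [hasDerivAt_iff_tendsto_slope] at h1
      refine h1.congr fun ε => ?_
      simp [slope, hY0]
    have hsum : ∀ ε : ℝ, ε ≠ 0 → (ε ^ k)⁻¹ * MvPolynomial.eval (Y (ε • v)) Q =
        ∑ j ∈ Finset.range (Q.totalDegree + 1), (if j < k then 0 else ε ^ (j - k) * MvPolynomial.eval (ε⁻¹ • Y (ε • v)) (MvPolynomial.homogeneousComponent j Q)) := by
      intro ε hε
      conv_lhs => rw [← MvPolynomial.sum_homogeneousComponent Q]
      rw [map_sum, Finset.mul_sum]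
      apply Finset.sum_congr rfl
      intro j _
      split_ifs with hj
      · rw [ih j hj (by omega)]; simp
      · rw [hscale ε hε, ← mul_assoc]
        congr 1
        push Not at hj
        rw [inv_mul_eq_iff_eq_mul₀ (pow_ne_zero _ hε), ← pow_add]
        congr 1; omega
    have hlim1 : Tendsto (fun ε : ℝ => (ε ^ k)⁻¹ * MvPolynomial.eval (Y (ε • v)) Q) (𝓝[≠] 0)
        (𝓝 (∑ j ∈ Finset.range (Q.totalDegree + 1), (if j < k then 0 else (0:ℝ) ^ (j - k) * MvPolynomial.eval v (MvPolynomial.homogeneousComponent j Q)))) := by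
      have : Tendsto (fun ε : ℝ => ∑ j ∈ Finset.range (Q.totalDegree + 1), (if j < k then 0 else ε ^ (j - k) * MvPolynomial.eval (ε⁻¹ • Y (ε • v)) (MvPolynomial.homogeneousComponent j Q))) (𝓝[≠] 0) (𝓝 (∑ j ∈ Finset.range (Q.totalDegree + 1), (if j < k then 0 else (0:ℝ) ^ (j - k) * MvPolynomial.eval v (MvPolynomial.homogeneousComponent j Q)))) := by
        apply tendsto_finsetSum
        intro j _
        split_ifs with hj
        · exact tendsto_const_nhds
        · apply Tendsto.mul
          · exact ((continuous_pow (j - k)).tendsto (0:ℝ)).mono_left nhdsWithin_le_nhds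
          · exact ((MvPolynomial.continuous_eval _).tendsto v).comp hYv
      refine this.congr' ?_
      filter_upwards [self_mem_nhdsWithin] with ε hε
      exact (hsum ε hε).symm
    have hlim2 : Tendsto (fun ε : ℝ => (ε ^ k)⁻¹ * MvPolynomial.eval (Y (ε • v)) Q) (𝓝[≠] 0) (𝓝 0) := by
      obtain ⟨C, hC⟩ := h.bound
      have hcont : Tendsto (fun ε : ℝ => ε • v) (𝓝[≠] 0) (𝓝 0) := by
        have : Tendsto (fun ε : ℝ => ε • v) (𝓝 0) (𝓝 ((0:ℝ) • v)) := (continuous_id.smul continuous_const).tendsto 0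
        rw [zero_smul] at this
        exact this.mono_left nhdsWithin_le_nhds
      have hb := hcont.eventually hC
      refine squeeze_zero_norm' (a := fun ε : ℝ => C * ‖v‖ ^ (m+1) * |ε| ^ (m + 1 - k)) ?_ ?_
      · filter_upwards [hb, self_mem_nhdsWithin] with ε h1 hε
        have hε : ε ≠ 0 := hε
        rw [norm_mul, norm_inv, norm_pow, Real.norm_eq_abs, inv_mul_le_iff₀ (by positivity)]
        refine h1.trans (le_of_eq ?_)
        rw [norm_pow, norm_norm, norm_smul, mul_pow, Real.norm_eq_abs]
        have : |ε| ^ (m+1) = |ε| ^ k * |ε| ^ (m+1-k) := by rw [← pow_add]; congr 1; omega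
        rw [this]; ring
      · have : Tendsto (fun ε : ℝ => C * ‖v‖ ^ (m+1) * |ε| ^ (m + 1 - k)) (𝓝 0) (𝓝 (C * ‖v‖ ^ (m+1) * |(0:ℝ)| ^ (m + 1 - k))) := by
          apply Continuous.tendsto; fun_prop
        rw [abs_zero, zero_pow (by omega), mul_zero] at this
        exact this.mono_left nhdsWithin_le_nhds
    have heq := tendsto_nhds_unique hlim1 hlim2
    by_cases hkd : k ∈ Finset.range (Q.totalDegree + 1)
    · rw [Finset.sum_eq_single_of_mem k hkd] at heq
      · simpa using heq
      · intro j _ hjk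
        split_ifs with hj
        · rfl
        · rw [zero_pow (by omega), zero_mul]
    · rw [MvPolynomial.homogeneousComponent_eq_zero]
      · simp
      · simpa [Nat.lt_succ_iff] using hkd
  intro d hd
  have := key d.degree hd
  have h2 := MvPolynomial.coeff_homogeneousComponent d.degree Q d
  rw [this] at h2
  simpa using h2.symm

open Asymptotics Filter Topology in
lemma eval_isBigO {ι : Type} [Fintype ι] (Q : MvPolynomial ι ℝ) (m : ℕ)
    (h : ∀ d : ι →₀ ℕ, d.degree ≤ m → Q.coeff d = 0) :
    (fun t : ι → ℝ => MvPolynomial.eval t Q) =O[𝓝 0] fun t => ‖t‖ ^ (m + 1) := by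
  classical
  simp_rw [MvPolynomial.eval_eq']
  apply IsBigO.fun_sum
  intro d hd
  have hdeg : m + 1 ≤ d.degree := by
    by_contra hlt
    exact (MvPolynomial.mem_support_iff.mp hd) (h d (by omega))
  apply IsBigO.const_mul_left
  apply IsBigO.of_bound 1
  have : ∀ᶠ t : ι → ℝ in 𝓝 0, ‖t‖ < 1 := by
    have := Metric.ball_mem_nhds (0 : ι → ℝ) one_pos
    filter_upwards [this] with t ht
    simpa using ht
  filter_upwards [this] with t ht
  rw [norm_prod, one_mul, norm_pow, norm_norm]
  calc ∏ i, ‖t i ^ d i‖ ≤ ∏ i, ‖t‖ ^ d i := by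
        apply Finset.prod_le_prod
        · intros; positivity
        · intro i _
          rw [norm_pow]
          gcongr
          exact norm_le_pi_norm t i
    _ = ‖t‖ ^ d.degree := by
        rw [Finset.prod_pow_eq_pow_sum]
        congr 1
        rw [Finsupp.degree_apply]
        symm
        apply Finset.sum_subset (Finset.subset_univ d.support)
        intro x _ hx; simpa using hx
    _ ≤ ‖t‖ ^ (m+1) := pow_le_pow_of_le_one (norm_nonneg _) ht.le hdeg
end

/- part JR -/
section
open Asymptotics Filter Topology in
/-- `u` has an `m`-jet at `0` with coefficients in `K`. -/
def JR (K : IntermediateField ℚ ℝ) (m : ℕ) (u : (Fin 3 → ℝ) → ℝ) : Prop :=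
  ∃ P : MvPolynomial (Fin 3) ℝ, (∀ d, P.coeff d ∈ K) ∧
    (fun t => u t - MvPolynomial.eval t P) =O[𝓝 0] fun t => ‖t‖ ^ (m + 1)

section
open Asymptotics Filter Topology
variable {K : IntermediateField ℚ ℝ} {m : ℕ}

lemma poly_bdd (P : MvPolynomial (Fin 3) ℝ) :
    (fun t => MvPolynomial.eval t P) =O[𝓝 0] fun _ : Fin 3 → ℝ => (1:ℝ) :=
  ((MvPolynomial.continuous_eval P).tendsto 0).isBigO_one ℝ

lemma npow_bdd (k : ℕ) : (fun t : Fin 3 → ℝ => ‖t‖ ^ k) =O[𝓝 0] fun _ : Fin 3 → ℝ => (1:ℝ) :=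
  ((continuous_norm.pow k).tendsto 0).isBigO_one ℝ

lemma JR.bdd {u} (h : JR K m u) : u =O[𝓝 0] fun _ => (1:ℝ) := by
  obtain ⟨P, -, hP⟩ := h
  simpa using (hP.trans (npow_bdd _)).add (poly_bdd P)

lemma JR.const {c : ℝ} (hc : c ∈ K) : JR K m fun _ => c := by
  classical
  refine ⟨MvPolynomial.C c, fun d => ?_, by simp [isBigO_zero]⟩
  rw [MvPolynomial.coeff_C]; split_ifs
  · exact hc
  · exact zero_mem K

lemma JR.coord (i : Fin 3) : JR K m fun t => t i := by
  classical
  refine ⟨MvPolynomial.X i, fun d => ?_, by simp [isBigO_zero]⟩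
  rw [MvPolynomial.coeff_X']; split_ifs
  · exact one_mem K
  · exact zero_mem K

lemma JR.add {u v} (hu : JR K m u) (hv : JR K m v) : JR K m fun t => u t + v t := by
  obtain ⟨P, hP, hP'⟩ := hu
  obtain ⟨Q, hQ, hQ'⟩ := hv
  refine ⟨P + Q, fun d => by rw [MvPolynomial.coeff_add]; exact add_mem (hP d) (hQ d), ?_⟩
  refine (hP'.add hQ').congr_left fun t => ?_
  rw [map_add]; ring

lemma JR.mul {u v} (hu : JR K m u) (hv : JR K m v) : JR K m fun t => u t * v t := by
  classical
  have hub := hu.bdd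
  obtain ⟨P, hP, hP'⟩ := hu
  obtain ⟨Q, hQ, hQ'⟩ := hv
  refine ⟨P * Q, fun d => ?_, ?_⟩
  · rw [MvPolynomial.coeff_mul]
    exact sum_mem fun x _ => mul_mem (hP _) (hQ _)
  · have h1 := hub.mul hQ'
    have h2 := hP'.mul (poly_bdd Q)
    simp only [one_mul, mul_one] at h1 h2
    refine (h1.add h2).congr_left fun t => ?_
    rw [map_mul]; ring

lemma JR.neg {u} (hu : JR K m u) : JR K m fun t => - u t := by
  simpa using (JR.const (neg_mem (one_mem K))).mul hu

lemma JR.sub {u v} (hu : JR K m u) (hv : JR K m v) : JR K m fun t => u t - v t := by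
  simpa [sub_eq_add_neg] using hu.add hv.neg

lemma JR.pow {u} (hu : JR K m u) (k : ℕ) : JR K m fun t => u t ^ k := by
  induction k with
  | zero => simpa using JR.const (one_mem K)
  | succ k ih => simpa [pow_succ] using ih.mul hu

lemma JR.sum {ι : Type*} (s : Finset ι) {u : ι → (Fin 3 → ℝ) → ℝ} (hu : ∀ i ∈ s, JR K m (u i)) :
    JR K m fun t => ∑ i ∈ s, u i t := by
  classical
  induction s using Finset.induction_on with
  | empty => simpa using JR.const (zero_mem K)
  | insert a s ha ih =>
    simp_rw [Finset.sum_insert ha]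
    exact (hu a (by simp)).add (ih fun i hi => hu i (by simp [hi]))

lemma JR.prod {ι : Type*} (s : Finset ι) {u : ι → (Fin 3 → ℝ) → ℝ} (hu : ∀ i ∈ s, JR K m (u i)) :
    JR K m fun t => ∏ i ∈ s, u i t := by
  classical
  induction s using Finset.induction_on with
  | empty => simpa using JR.const (one_mem K)
  | insert a s ha ih =>
    simp_rw [Finset.prod_insert ha]
    exact (hu a (by simp)).mul (ih fun i hi => hu i (by simp [hi]))

lemma JR.of_isBigO {u v} (hu : JR K m u)
    (h : (fun t => v t - u t) =O[𝓝 0] fun t => ‖t‖ ^ (m + 1)) : JR K m v := by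
  obtain ⟨P, hP, hP'⟩ := hu
  refine ⟨P, hP, (h.add hP').congr_left fun t => ?_⟩
  ring

/-- squared Euclidean norm -/
def sq3 (t : Fin 3 → ℝ) : ℝ := t 0 ^ 2 + t 1 ^ 2 + t 2 ^ 2

lemma sq3_nonneg (t) : 0 ≤ sq3 t := by unfold sq3; positivity

lemma sq3_JR : JR K m sq3 :=
  (((JR.coord 0).pow 2).add ((JR.coord 1).pow 2)).add ((JR.coord 2).pow 2)

lemma coord_isBigO (i : Fin 3) : (fun t : Fin 3 → ℝ => t i) =O[𝓝 0] fun t => ‖t‖ :=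
  IsBigO.of_bound 1 (Eventually.of_forall fun t => by
    rw [norm_norm, one_mul]; exact norm_le_pi_norm t i)

lemma norm_sq_isBigO : (fun t : Fin 3 → ℝ => ‖t‖ ^ 2) =O[𝓝 0] fun t => ‖t‖ := by
  have h := (isBigO_refl (fun t : Fin 3 → ℝ => ‖t‖) (𝓝 0)).mul (npow_bdd 1)
  simpa [pow_two] using h

lemma sq3_isBigO : sq3 =O[𝓝 0] fun t => ‖t‖ := by
  have h : ∀ i : Fin 3, (fun t : Fin 3 → ℝ => t i ^ 2) =O[𝓝 0] fun t => ‖t‖ :=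
    fun i => ((coord_isBigO i).pow 2).trans norm_sq_isBigO
  exact ((h 0).add (h 1)).add (h 2)

lemma inv_JR : JR K m fun t => (1 + sq3 t)⁻¹ := by
  have h1 : JR K m fun t => ∑ k ∈ Finset.range (m + 1), (- sq3 t) ^ k :=
    JR.sum _ fun k _ => (sq3_JR.neg).pow k
  refine h1.of_isBigO ?_
  have h2 : ∀ t, (1 + sq3 t)⁻¹ - ∑ k ∈ Finset.range (m + 1), (- sq3 t) ^ k
      = (- sq3 t) ^ (m + 1) * (1 + sq3 t)⁻¹ := by
    intro t
    have h3 : (1 + sq3 t) ≠ 0 := by have := sq3_nonneg t; positivity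
    have h4 := mul_neg_geom_sum (- sq3 t) (m + 1)
    rw [sub_neg_eq_add] at h4
    have h5 : ∑ k ∈ Finset.range (m + 1), (- sq3 t) ^ k = (1 - (- sq3 t) ^ (m+1)) * (1 + sq3 t)⁻¹ := by
      rw [← h4]; field_simp
    rw [h5]; ring
  simp_rw [h2]
  have h6 : (fun t => (1 + sq3 t)⁻¹) =O[𝓝 0] fun _ : Fin 3 → ℝ => (1:ℝ) :=
    IsBigO.of_bound 1 (Eventually.of_forall fun t => by
      have := sq3_nonneg t
      rw [norm_inv, Real.norm_of_nonneg (by positivity)]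
      simp
      exact inv_le_one_of_one_le₀ (by linarith))
  have h7 : (fun t => - sq3 t) =O[𝓝 0] fun t => ‖t‖ := sq3_isBigO.neg_left
  simpa using (h7.pow (m+1)).mul h6

/-- complex version -/
def JC (K : IntermediateField ℚ ℝ) (m : ℕ) (u : (Fin 3 → ℝ) → ℂ) : Prop :=
  JR K m (fun t => (u t).re) ∧ JR K m (fun t => (u t).im)

lemma JC.const {c : ℂ} (h1 : c.re ∈ K) (h2 : c.im ∈ K) : JC K m fun _ => c :=
  ⟨JR.const h1, JR.const h2⟩

lemma JC.one : JC K m fun _ => (1:ℂ) :=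
  JC.const (by simpa using one_mem K) (by simpa using zero_mem K)

lemma JC.zero : JC K m fun _ => (0:ℂ) :=
  JC.const (by simpa using zero_mem K) (by simpa using zero_mem K)

lemma JC.add {u v} (hu : JC K m u) (hv : JC K m v) : JC K m fun t => u t + v t :=
  ⟨by simpa using hu.1.add hv.1, by simpa using hu.2.add hv.2⟩

lemma JC.sub {u v} (hu : JC K m u) (hv : JC K m v) : JC K m fun t => u t - v t :=
  ⟨by simpa using hu.1.sub hv.1, by simpa using hu.2.sub hv.2⟩

lemma JC.mul {u v} (hu : JC K m u) (hv : JC K m v) : JC K m fun t => u t * v t :=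
  ⟨by simpa using (hu.1.mul hv.1).sub (hu.2.mul hv.2),
    by simpa using (hu.1.mul hv.2).add (hu.2.mul hv.1)⟩

lemma JC.conj {u} (hu : JC K m u) : JC K m fun t => (starRingEnd ℂ) (u t) :=
  ⟨by simpa using hu.1, by simpa using hu.2.neg⟩

lemma JC.pow {u} (hu : JC K m u) (k : ℕ) : JC K m fun t => u t ^ k := by
  induction k with
  | zero => simpa using JC.one
  | succ k ih => simpa [pow_succ] using ih.mul hu

lemma JC.sum {ι : Type*} (s : Finset ι) {u : ι → (Fin 3 → ℝ) → ℂ} (hu : ∀ i ∈ s, JC K m (u i)) :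
    JC K m fun t => ∑ i ∈ s, u i t := by
  classical
  induction s using Finset.induction_on with
  | empty => simpa using JC.zero
  | insert a s ha ih =>
    simp_rw [Finset.sum_insert ha]
    exact (hu a (by simp)).add (ih fun i hi => hu i (by simp [hi]))

lemma JC.normSq {u} (hu : JC K m u) : JR K m fun t => ‖u t‖ ^ 2 := by
  simp_rw [← Complex.normSq_eq_norm_sq, Complex.normSq_apply]
  exact (hu.1.mul hu.1).add (hu.2.mul hu.2)

lemma JC.of_isBigO {u v} (hu : JC K m u)
    (h : (fun t => v t - u t) =O[𝓝 0] fun t => ‖t‖ ^ (m + 1)) : JC K m v := by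
  constructor
  · refine hu.1.of_isBigO (IsBigO.trans (IsBigO.of_bound 1 (Eventually.of_forall fun t => ?_)) h)
    rw [one_mul, ← Complex.sub_re]; exact Complex.abs_re_le_norm _
  · refine hu.2.of_isBigO (IsBigO.trans (IsBigO.of_bound 1 (Eventually.of_forall fun t => ?_)) h)
    rw [one_mul, ← Complex.sub_im]; exact Complex.abs_im_le_norm _

end
end

/- part Core -/
section
open Asymptotics Filter Topology in
set_option maxHeartbeats 1000000 in
theorem jet_core {σ : Type} [Fintype σ] [DecidableEq σ] (S : Finset (σ →₀ ℕ)) (r n m : ℕ)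
    (hm : m = 3 * r) (hS : ∀ d : σ →₀ ℕ, d.degree ≤ m → d ∈ S) (hr : n < (r + 1) ^ 3)
    (β : S → ℝ) (hβ : AlgebraicIndependent ℚ β)
    (J : Set ℝ) (hJ : J.Finite) (hn : J.ncard ≤ n)
    (X : σ → (Fin 3 → ℝ) → ℝ) (U F0 : (Fin 3 → ℝ) → ℝ)
    (hX : ∀ s, JR (IntermediateField.adjoin ℚ J) m (X s))
    (hU : JR (IntermediateField.adjoin ℚ J) m U)
    (hF0 : JR (IntermediateField.adjoin ℚ J) m F0)
    (hUc : ContinuousAt U 0) (hU0 : U 0 ≠ 0)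
    (X' : (Fin 3 → ℝ) →L[ℝ] (σ → ℝ)) (hX' : HasFDerivAt (fun t s => X s t) X' 0)
    (hinj : Function.Injective X')
    (heq : ∀ᶠ t in 𝓝 0, F0 t + U t * ∑ μ : S, β μ * ∏ s, X s t ^ (μ.1 s) = 0) : False := by
  classical
  set K := IntermediateField.adjoin ℚ J with hK
  have hmon : ∀ μ : S, JR K m fun t => U t * ∏ s, X s t ^ (μ.1 s) := fun μ =>
    hU.mul (JR.prod _ fun s _ => (hX s).pow _)
  choose P hPK hPO using hmon
  obtain ⟨P0, hP0K, hP0O⟩ := hF0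
  -- vanishing of the coefficients of the total polynomial
  have hcoef : ∀ ν : Fin 3 →₀ ℕ, ν.degree ≤ m → (P0 + ∑ μ : S, β μ • P μ).coeff ν = 0 := by
    apply poly_lowest _ m id rfl (hasFDerivAt_id _)
    have h1 : (fun t => (F0 t - MvPolynomial.eval t P0) + ∑ μ : S, β μ * (U t * ∏ s, X s t ^ (μ.1 s) - MvPolynomial.eval t (P μ))) =O[𝓝 0] fun t => ‖t‖ ^ (m + 1) :=
      hP0O.add (IsBigO.fun_sum fun μ _ => (hPO μ).const_mul_left _)
    refine (h1.neg_left).congr' ?_ EventuallyEq.rfl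
    filter_upwards [heq] with t ht
    have h2 : F0 t = - (U t * ∑ μ : S, β μ * ∏ s, X s t ^ (μ.1 s)) := by linarith
    rw [h2]
    simp only [map_add, map_sum, MvPolynomial.smul_eval, id, Finset.mul_sum, mul_sub, Finset.sum_sub_distrib]
    have h3 : ∀ μ : S, U t * (β μ * ∏ s, X s t ^ (μ.1 s)) = β μ * (U t * ∏ s, X s t ^ (μ.1 s)) := fun μ => by ring
    simp only [h3]
    ring
  have hcoef' : ∀ ν : Fin 3 →₀ ℕ, ν.degree ≤ m → ∑ μ : S, (P μ).coeff ν * β μ ∈ K := by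
    intro ν hν
    have := hcoef ν hν
    simp only [MvPolynomial.coeff_add, MvPolynomial.coeff_sum, MvPolynomial.coeff_smul, smul_eq_mul] at this
    have h2 : ∑ μ : S, (P μ).coeff ν * β μ = - P0.coeff ν := by
      have h3 : ∑ μ : S, (P μ).coeff ν * β μ = ∑ μ : S, β μ * (P μ).coeff ν :=
        Finset.sum_congr rfl fun _ _ => mul_comm _ _
      rw [h3]; linarith
    rw [h2]
    exact neg_mem (hP0K ν)
  set W := Submodule.span ℝ {a : S → ℝ | (∀ μ, a μ ∈ IntermediateField.adjoin ℚ J) ∧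
      ∑ μ, a μ * β μ ∈ IntermediateField.adjoin ℚ J} with hW
  have hWn : Module.finrank ℝ W ≤ n := lemmaA β hβ J hJ n hn
  have hrow : ∀ ν : Fin 3 →₀ ℕ, ν.degree ≤ m → (fun μ : S => (P μ).coeff ν) ∈ W :=
    fun ν hν => Submodule.subset_span ⟨fun μ => hPK μ ν, hcoef' ν hν⟩
  obtain ⟨Λ, hΛ⟩ := LinearMap.exists_leftInverse_of_injective (X' : (Fin 3 → ℝ) →ₗ[ℝ] (σ → ℝ))
    (LinearMap.ker_eq_bot.mpr hinj)
  let x0 : σ → ℝ := fun s => X s 0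
  let aff : Fin 3 → MvPolynomial σ ℝ := fun i =>
    ∑ s, MvPolynomial.C (Λ (Pi.single s 1) i) * (MvPolynomial.X s - MvPolynomial.C (x0 s))
  have haff : ∀ x i, MvPolynomial.eval x (aff i) = Λ (x - x0) i := by
    intro x i
    rw [LinearMap.pi_apply_eq_sum_univ Λ (x - x0), Finset.sum_apply]
    simp only [aff, map_sum, map_mul, map_sub, MvPolynomial.eval_C, MvPolynomial.eval_X]
    apply Finset.sum_congr rfl
    intro s _
    simp only [Pi.smul_apply, smul_eq_mul, Pi.sub_apply]
    rw [mul_comm]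
    have hsing : (Pi.single s 1 : σ → ℝ) = fun j => if s = j then 1 else 0 := by
      funext j
      simp [Pi.single_apply, eq_comm]
    rw [hsing]
  have haffdeg : ∀ i, (aff i).totalDegree ≤ 1 := by
    intro i
    apply MvPolynomial.totalDegree_finsetSum_le
    intro s _
    refine (MvPolynomial.totalDegree_mul _ _).trans ?_
    rw [MvPolynomial.totalDegree_C, zero_add]
    refine (MvPolynomial.totalDegree_sub _ _).trans ?_
    simp
  let ex : (Fin 3 → Fin (r + 1)) → (Fin 3 →₀ ℕ) := fun e => Finsupp.equivFunOnFinite.symm (fun i => (e i : ℕ))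
  have hex : Function.Injective ex := by
    intro e e' h
    funext i
    have := DFunLike.congr_fun h i
    simp only [ex, Finsupp.equivFunOnFinite_symm_apply_apply] at this
    exact Fin.ext this
  let Qof : ((Fin 3 → Fin (r + 1)) → ℝ) →ₗ[ℝ] MvPolynomial (Fin 3) ℝ :=
    Fintype.linearCombination ℝ (fun e => MvPolynomial.monomial (ex e) (1:ℝ))
  let B : MvPolynomial (Fin 3) ℝ →ₐ[ℝ] MvPolynomial σ ℝ := MvPolynomial.aeval aff
  have hBdeg : ∀ q, (B (Qof q)).totalDegree ≤ m := by
    intro q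
    simp only [Qof, Fintype.linearCombination_apply, map_sum, map_smul]
    apply MvPolynomial.totalDegree_finsetSum_le
    intro e _
    refine (MvPolynomial.totalDegree_smul_le _ _).trans ?_
    simp only [B, MvPolynomial.aeval_monomial, map_one, one_mul]
    rw [Finsupp.prod_fintype _ _ (by simp)]
    refine (MvPolynomial.totalDegree_finsetProd _ _).trans ?_
    calc ∑ i, (aff i ^ (ex e i)).totalDegree ≤ ∑ i : Fin 3, r := by
          apply Finset.sum_le_sum
          intro i _
          refine (MvPolynomial.totalDegree_pow _ _).trans ?_
          have h1 := haffdeg i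
          have h2 : ex e i ≤ r := by
            simp only [ex, Finsupp.equivFunOnFinite_symm_apply_apply]
            exact Nat.lt_succ_iff.mp (e i).2
          nlinarith
      _ = m := by simp [hm]
  let T : ((Fin 3 → Fin (r + 1)) → ℝ) →ₗ[ℝ] (W → ℝ) :=
    { toFun := fun q w => ∑ μ : S, (B (Qof q)).coeff μ.1 * (w : S → ℝ) μ
      map_add' := by
        intro q q'; funext w
        simp only [map_add, MvPolynomial.coeff_add, add_mul, Finset.sum_add_distrib, Pi.add_apply]
      map_smul' := by
        intro c q; funext w
        simp only [map_smul, MvPolynomial.coeff_smul, smul_eq_mul, Pi.smul_apply, Finset.mul_sum, RingHom.id_apply, mul_assoc] }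
  let T2 : ((Fin 3 → Fin (r + 1)) → ℝ) →ₗ[ℝ] (Fin (Module.finrank ℝ W) → ℝ) :=
    { toFun := fun q i => T q (Module.finBasis ℝ W i)
      map_add' := by intro q q'; simp only [map_add]; rfl
      map_smul' := by intro c q; simp only [map_smul]; rfl }
  have hker : LinearMap.ker T2 ≠ ⊥ := by
    apply LinearMap.ker_ne_bot_of_finrank_lt
    simp
    omega
  obtain ⟨q, hq, hq0⟩ := Submodule.exists_mem_ne_zero_of_ne_bot hker
  have hqW : ∀ w ∈ W, ∑ μ : S, (B (Qof q)).coeff μ.1 * w μ = 0 := by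
    intro w hw
    let Lin : W →ₗ[ℝ] ℝ :=
      { toFun := fun w => ∑ μ : S, (B (Qof q)).coeff μ.1 * (w : S → ℝ) μ
        map_add' := by
          intro w w'
          simp only [Submodule.coe_add, Pi.add_apply, mul_add, Finset.sum_add_distrib]
        map_smul' := by
          intro c w
          simp only [Submodule.coe_smul, Pi.smul_apply, smul_eq_mul, Finset.mul_sum, RingHom.id_apply]
          exact Finset.sum_congr rfl fun _ _ => by ring }
    have : Lin = 0 := by
      apply (Module.finBasis ℝ W).ext
      intro i
      exact congrFun (LinearMap.mem_ker.mp hq) i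
    exact LinearMap.congr_fun this ⟨w, hw⟩
  -- resulting polynomial
  have hR2 : (fun t : Fin 3 → ℝ => MvPolynomial.eval t (∑ μ : S, (B (Qof q)).coeff μ.1 • P μ)) =O[𝓝 0] fun t => ‖t‖ ^ (m + 1) := by
    apply eval_isBigO
    intro ν hν
    simp only [MvPolynomial.coeff_sum, MvPolynomial.coeff_smul, smul_eq_mul]
    exact hqW _ (hrow ν hν)
  let Y : (Fin 3 → ℝ) → (Fin 3 → ℝ) := fun t => Λ (fun s => X s t - X s 0)
  have heval : ∀ x : σ → ℝ, ∑ μ : S, (B (Qof q)).coeff μ.1 * ∏ s, x s ^ (μ.1 s) = MvPolynomial.eval (fun i => Λ (x - x0) i) (Qof q) := by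
    intro x
    have h1 : MvPolynomial.eval x (B (Qof q)) = MvPolynomial.eval (fun i => Λ (x - x0) i) (Qof q) := by
      simp only [B]
      rw [MvPolynomial.aeval_def, MvPolynomial.eval₂_eq_eval_map]
      rw [← MvPolynomial.eval₂_eq_eval_map]
      change (MvPolynomial.eval x) (MvPolynomial.eval₂ _ aff (Qof q)) = _
      rw [MvPolynomial.eval, MvPolynomial.coe_eval₂Hom]
      rw [← MvPolynomial.coe_eval₂Hom (RingHom.id ℝ) x, MvPolynomial.hom_eval₂]
      have : (fun i => (MvPolynomial.eval₂Hom (RingHom.id ℝ) x) (aff i)) = fun i => Λ (x - x0) i := by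
        funext i; exact haff x i
      change MvPolynomial.eval₂ _ (fun i => (MvPolynomial.eval₂Hom (RingHom.id ℝ) x) (aff i)) (Qof q) = MvPolynomial.eval₂ _ _ _
      rw [this]
      congr 1
      ext a
      simp
    rw [← h1, MvPolynomial.eval_eq']
    rw [Finset.sum_coe_sort S (fun μ => (B (Qof q)).coeff μ * ∏ s, x s ^ (μ s))]
    symm
    apply Finset.sum_subset
    · intro d hd
      apply hS
      refine le_trans ?_ (hBdeg q)
      have := MvPolynomial.le_totalDegree hd
      simpa [Finsupp.degree_apply, Finsupp.sum] using this
    · intro d _ hd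
      rw [MvPolynomial.notMem_support_iff.mp hd, zero_mul]
  have hUQ : (fun t => U t * MvPolynomial.eval (Y t) (Qof q)) =O[𝓝 0] fun t => ‖t‖ ^ (m + 1) := by
    have h1 : (fun t => ∑ μ : S, (B (Qof q)).coeff μ.1 * (U t * ∏ s, X s t ^ (μ.1 s) - MvPolynomial.eval t (P μ))) =O[𝓝 0] fun t => ‖t‖ ^ (m + 1) :=
      IsBigO.fun_sum fun μ _ => (hPO μ).const_mul_left _
    refine (h1.add hR2).congr_left fun t => ?_
    have h2 := heval (fun s => X s t)
    have h3 : (fun i => Λ ((fun s => X s t) - x0) i) = Y t := rfl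
    rw [h3] at h2
    rw [← h2]
    simp only [map_sum, MvPolynomial.smul_eval, mul_sub, Finset.sum_sub_distrib, sub_add_cancel, Finset.mul_sum]
    exact Finset.sum_congr rfl fun _ _ => by ring
  have hQ : (fun t => MvPolynomial.eval (Y t) (Qof q)) =O[𝓝 0] fun t => ‖t‖ ^ (m + 1) := by
    have h1 : (fun t => (U t)⁻¹) =O[𝓝 0] fun _ => (1:ℝ) := ((hUc.tendsto).inv₀ hU0).isBigO_one ℝ
    have h2 := h1.mul hUQ
    simp only [one_mul] at h2
    refine h2.congr' ?_ EventuallyEq.rfl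
    filter_upwards [hUc.eventually_ne hU0] with t ht
    field_simp
  have hY0 : Y 0 = 0 := by
    simp only [Y, sub_self]
    exact map_zero Λ
  have hYd : HasFDerivAt Y (ContinuousLinearMap.id ℝ (Fin 3 → ℝ)) 0 := by
    let Λc : (σ → ℝ) →L[ℝ] (Fin 3 → ℝ) := LinearMap.toContinuousLinearMap Λ
    have h1 : HasFDerivAt (fun t => (fun s => X s t) - x0) X' 0 := hX'.sub_const x0
    have h2 := Λc.hasFDerivAt.comp (0 : Fin 3 → ℝ) h1
    have h3 : Λc.comp X' = ContinuousLinearMap.id ℝ (Fin 3 → ℝ) := by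
      ext1 v
      exact LinearMap.congr_fun hΛ v
    rw [h3] at h2
    exact h2
  have hfin := poly_lowest (Qof q) m Y hY0 hYd hQ
  apply hq0
  funext e
  have h1 := hfin (ex e) (by
    rw [Finsupp.degree_eq_sum]
    calc ∑ i, ex e i ≤ ∑ i : Fin 3, r := by
          apply Finset.sum_le_sum
          intro i _
          simp only [ex, Finsupp.equivFunOnFinite_symm_apply_apply]
          exact Nat.lt_succ_iff.mp (e i).2
      _ = m := by simp [hm]
      _ ≤ m := le_rfl)
  simp only [Qof, Fintype.linearCombination_apply, MvPolynomial.coeff_sum, MvPolynomial.coeff_smul, MvPolynomial.coeff_monomial, smul_eq_mul] at h1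
  rw [Finset.sum_eq_single e] at h1
  · simpa using h1
  · intro b _ hb
    rw [if_neg (fun h => hb (hex h)), mul_zero]
  · simp
end

/- part Holo -/
section
section
open Metric Asymptotics Filter Topology

variable {E F : Type*} [NormedAddCommGroup E] [NormedSpace ℂ E]
  [NormedAddCommGroup F] [NormedSpace ℂ F]

lemma holo_line {U : Set E} (hU : IsOpen U) {f : E → F} (hf : DifferentiableOn ℂ f U) (z v : E) (ζ : ℂ)
    (h : z + ζ • v ∈ U) :
    HasDerivAt (fun ζ : ℂ => f (z + ζ • v)) (fderiv ℂ f (z + ζ • v) v) ζ := by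
  have h1 : HasDerivAt (fun ζ : ℂ => z + ζ • v) v ζ := by
    simpa using ((hasDerivAt_id ζ).smul_const v).const_add z
  exact ((hf.differentiableAt (hU.mem_nhds h)).hasFDerivAt).comp_hasDerivAt ζ h1

lemma cauchy_op {U : Set E} (hU : IsOpen U) {f : E → F} (hf : DifferentiableOn ℂ f U) (z : E)
    {R C : ℝ} (hR : 0 < R) (hC0 : 0 ≤ C) (hsub : closedBall z R ⊆ U) (hC : ∀ x ∈ closedBall z R, ‖f x‖ ≤ C) :
    ‖fderiv ℂ f z‖ ≤ C / R := by
  apply ContinuousLinearMap.opNorm_le_bound _ (by positivity)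
  intro v
  by_cases hv : v = 0
  · simp [hv]
  have hv' : 0 < ‖v‖ := norm_pos_iff.mpr hv
  have hmem : ∀ ζ : ℂ, ‖ζ‖ ≤ R / ‖v‖ → z + ζ • v ∈ closedBall z R := by
    intro ζ hζ
    rw [mem_closedBall, dist_eq_norm, add_sub_cancel_left, norm_smul]
    rwa [le_div_iff₀ hv'] at hζ
  have h1 : ‖deriv (fun ζ : ℂ => f (z + ζ • v)) 0‖ ≤ C / (R / ‖v‖) := by
    apply Complex.norm_deriv_le_of_forall_mem_sphere_norm_le (by positivity)
    · apply DifferentiableOn.diffContOnCl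
      intro ζ hζ
      rw [closure_ball _ (by positivity)] at hζ
      exact (holo_line hU hf z v ζ (hsub (hmem ζ (by simpa using hζ)))).differentiableAt.differentiableWithinAt
    · intro ζ hζ
      exact hC _ (hmem ζ (by simpa using (mem_sphere.mp hζ).le))
  have h2 := holo_line hU hf z v 0 (hsub (hmem 0 (by simp; positivity)))
  rw [h2.deriv] at h1
  simp only [zero_smul, add_zero] at h1
  refine h1.trans (le_of_eq ?_)
  field_simp

set_option maxHeartbeats 800000 in
lemma holo_fderiv_apply [FiniteDimensional ℂ E] [CompleteSpace F] {U : Set E} (hU : IsOpen U) {f : E → F} (hf : DifferentiableOn ℂ f U) (v : E) :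
    DifferentiableOn ℂ (fun z => fderiv ℂ f z v) U := by
  intro z0 hz0
  apply DifferentiableAt.differentiableWithinAt
  -- choose radius
  obtain ⟨ε, hε, hεU⟩ := Metric.isOpen_iff.mp hU z0 hz0
  obtain ⟨δ, hδ, hδb⟩ : ∃ δ > 0, ∀ x ∈ ball z0 δ, ‖f x‖ ≤ ‖f z0‖ + 1 := by
    have hc : ContinuousAt f z0 := (hf.differentiableAt (hU.mem_nhds hz0)).continuousAt
    have : ∀ᶠ x in 𝓝 z0, ‖f x‖ < ‖f z0‖ + 1 := hc.norm.eventually_lt continuousAt_const (by simp)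
    obtain ⟨δ, hδ, h⟩ := Metric.eventually_nhds_iff_ball.mp this
    exact ⟨δ, hδ, fun x hx => (h x hx).le⟩
  set R := min ε δ / 4 with hRdef
  have hR : 0 < R := by positivity
  have hRε : 4 * R ≤ ε := by rw [hRdef]; linarith [min_le_left ε δ]
  have hRδ : 4 * R ≤ δ := by rw [hRdef]; linarith [min_le_right ε δ]
  set B := ‖f z0‖ + 1
  have hB : 0 ≤ B := by positivity
  have hU4 : ball z0 (4 * R) ⊆ U := (ball_subset_ball hRε).trans hεU
  have hb4 : ∀ x ∈ ball z0 (4 * R), ‖f x‖ ≤ B := fun x hx => hδb x (ball_subset_ball hRδ hx)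
  have hcb : ∀ k : ℝ, ∀ z ∈ ball z0 (k * R), closedBall z R ⊆ ball z0 ((k + 1) * R) := by
    intro k z hz
    apply closedBall_subset_ball'
    rw [mem_ball] at hz
    linarith
  have hdA : ∀ z ∈ ball z0 (4 * R), DifferentiableAt ℂ f z := fun z hz => hf.differentiableAt (hU.mem_nhds (hU4 hz))
  have hA : ∀ z ∈ ball z0 (3 * R), ‖fderiv ℂ f z‖ ≤ B / R := by
    intro z hz
    have h1 := hcb 3 z hz
    norm_num at h1
    exact cauchy_op hU hf z hR hB (h1.trans hU4) (fun x hx => hb4 x (h1 hx))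
  have h34 : ball z0 (3 * R) ⊆ ball z0 (4 * R) := ball_subset_ball (by linarith)
  have h23 : ball z0 (2 * R) ⊆ ball z0 (3 * R) := ball_subset_ball (by linarith)
  set L1 := B / R
  have hL1 : 0 ≤ L1 := by positivity
  have hLip : ∀ x ∈ ball z0 (3 * R), ∀ y ∈ ball z0 (3 * R), ‖f y - f x‖ ≤ L1 * ‖y - x‖ := by
    intro x hx y hy
    let _ : NormedSpace ℝ E := NormedSpace.restrictScalars ℝ ℂ E
    exact Convex.norm_image_sub_le_of_norm_fderiv_le (𝕜 := ℂ) (fun z hz => hdA z (h34 hz)) hA (convex_ball _ _) hx hy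
  set L2 := L1 / R
  have hL2 : 0 ≤ L2 := by positivity
  have hLip2 : ∀ x ∈ ball z0 (2 * R), ∀ y ∈ ball z0 (2 * R), ‖fderiv ℂ f y - fderiv ℂ f x‖ ≤ L2 * ‖y - x‖ := by
    intro x hx y hy
    have hx1 := hcb 2 x hx
    have hy1 := hcb 2 y hy
    norm_num at hx1 hy1
    have htr : ∀ u ∈ closedBall x R, u + (y - x) ∈ closedBall y R := by
      intro u hu
      rw [mem_closedBall, dist_eq_norm] at hu ⊢
      convert! hu using 2
      abel
    let W : Set E := U ∩ (fun u => u + (y - x)) ⁻¹' U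
    have hW : IsOpen W := hU.inter (hU.preimage (by fun_prop))
    have hgd : DifferentiableOn ℂ (fun u => f (u + (y - x)) - f u) W := by
      apply DifferentiableOn.sub
      · exact hf.comp (by fun_prop) (fun u hu => hu.2)
      · exact hf.mono Set.inter_subset_left
    have h1 := cauchy_op (C := L1 * ‖y - x‖) hW hgd x hR (by positivity) (fun u hu => ⟨hU4 (h34 (hx1 hu)), hU4 (h34 (hy1 (htr u hu)))⟩) (by
      intro u hu
      have := hLip u (hx1 hu) _ (hy1 (htr u hu))
      simpa using this)
    have h2 : fderiv ℂ (fun u => f (u + (y - x)) - f u) x = fderiv ℂ f y - fderiv ℂ f x := by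
      have e1 : DifferentiableAt ℂ f x := hdA x (h34 (h23 hx))
      have e2 : DifferentiableAt ℂ f (x + (y - x)) := by
        rw [add_sub_cancel]; exact hdA y (h34 (h23 hy))
      have e3 : DifferentiableAt ℂ (fun u => f (u + (y - x))) x := e2.comp x (by fun_prop)
      rw [fderiv_fun_sub e3 e1, fderiv_comp_add_right, add_sub_cancel]
    rw [h2] at h1
    refine h1.trans (le_of_eq ?_)
    simp only [L2]; ring
  have hTay : ∀ x ∈ ball z0 (2 * R), ∀ w, x + w ∈ ball z0 (2 * R) →
      ‖f (x + w) - f x - fderiv ℂ f x w‖ ≤ L2 * ‖w‖ ^ 2 := by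
    intro x hx w hxw
    let _ : NormedSpace ℝ E := NormedSpace.restrictScalars ℝ ℂ E
    have h1 := Convex.norm_image_sub_le_of_norm_fderiv_le' (𝕜 := ℂ) (f := f) (φ := fderiv ℂ f x)
      (s := ball z0 (2 * R) ∩ closedBall x ‖w‖) (C := L2 * ‖w‖) (x := x) (y := x + w)
      (fun z hz => hdA z (h34 (h23 hz.1))) (by
        intro z hz
        refine (hLip2 x hx z hz.1).trans ?_
        have := mem_closedBall.mp hz.2
        rw [dist_eq_norm] at this
        gcongr) ((convex_ball _ _).inter (convex_closedBall _ _)) ⟨hx, by simp⟩ ⟨hxw, by simp⟩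
    rw [add_sub_cancel_left] at h1
    refine h1.trans (le_of_eq (by ring))
  -- the direction v
  set r := R / (‖v‖ + 1) with hr
  have hr0 : 0 < r := by positivity
  have hζ : ∀ ζ ∈ ball (0:ℂ) r, z0 + ζ • v ∈ ball z0 R := by
    intro ζ hζ
    rw [mem_ball, dist_eq_norm, sub_zero] at hζ
    rw [mem_ball, dist_eq_norm, add_sub_cancel_left, norm_smul]
    rw [hr, lt_div_iff₀ (by positivity)] at hζ
    nlinarith [norm_nonneg ζ]
  have h12 : ball z0 R ⊆ ball z0 (2 * R) := ball_subset_ball (by linarith)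
  have hadd : ∀ x ∈ ball z0 R, ∀ w : E, ‖w‖ < R → x + w ∈ ball z0 (2 * R) := by
    intro x hx w hw
    rw [mem_ball, dist_eq_norm] at hx ⊢
    have : x + w - z0 = (x - z0) + w := by abel
    rw [this]
    linarith [norm_add_le (x - z0) w]
  have hFw : ∀ w, DifferentiableOn ℂ (fun ζ : ℂ => fderiv ℂ f (z0 + ζ • v) w) (ball 0 r) := by
    intro w
    let Q : ℂ → ℂ → F := fun t ζ => t⁻¹ • (f (z0 + ζ • v + t • w) - f (z0 + ζ • v))
    have hsmall : ∀ᶠ t in 𝓝[≠] (0:ℂ), ‖t • w‖ < R := by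
      have : Tendsto (fun t : ℂ => ‖t • w‖) (𝓝 0) (𝓝 ‖(0:ℂ) • w‖) := by
        apply Continuous.tendsto; fun_prop
      rw [zero_smul, norm_zero] at this
      exact (this.eventually_lt_const hR).filter_mono nhdsWithin_le_nhds
    have hunif : TendstoUniformlyOn Q (fun ζ : ℂ => fderiv ℂ f (z0 + ζ • v) w) (𝓝[≠] 0) (ball 0 r) := by
      rw [Metric.tendstoUniformlyOn_iff]
      intro η hη
      have hs2 : ∀ᶠ t in 𝓝[≠] (0:ℂ), L2 * ‖w‖ ^ 2 * ‖t‖ < η := by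
        have : Tendsto (fun t : ℂ => L2 * ‖w‖ ^ 2 * ‖t‖) (𝓝 0) (𝓝 (L2 * ‖w‖ ^ 2 * ‖(0:ℂ)‖)) := by
          apply Continuous.tendsto; fun_prop
        rw [norm_zero, mul_zero] at this
        exact (this.eventually_lt_const hη).filter_mono nhdsWithin_le_nhds
      filter_upwards [hsmall, hs2, self_mem_nhdsWithin] with t ht1 ht2 ht0 ζ hζm
      have ht0 : t ≠ 0 := ht0
      have h1 := hTay _ (h12 (hζ ζ hζm)) (t • w) (hadd _ (hζ ζ hζm) _ ht1)
      rw [dist_comm, dist_eq_norm]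
      have h2 : Q t ζ - fderiv ℂ f (z0 + ζ • v) w = t⁻¹ • (f (z0 + ζ • v + t • w) - f (z0 + ζ • v) - fderiv ℂ f (z0 + ζ • v) (t • w)) := by
        simp only [Q]
        rw [map_smul, smul_sub t⁻¹ (_ - _), inv_smul_smul₀ ht0]
      rw [h2, norm_smul, norm_inv]
      refine lt_of_le_of_lt ?_ ht2
      rw [inv_mul_le_iff₀ (norm_pos_iff.mpr ht0)]
      refine h1.trans (le_of_eq ?_)
      rw [norm_smul]; ring
    refine (hunif.tendstoLocallyUniformlyOn).differentiableOn ?_ isOpen_ball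
    filter_upwards [hsmall] with t ht ζ hζm
    apply DifferentiableAt.differentiableWithinAt
    apply DifferentiableAt.const_smul
    apply DifferentiableAt.sub
    · exact (hdA _ (h34 (h23 (hadd _ (hζ ζ hζm) _ ht)))).comp ζ (by fun_prop)
    · exact (hdA _ (h34 (h23 (h12 (hζ ζ hζm))))).comp ζ (by fun_prop)
  have hD : DifferentiableAt ℂ (fun ζ : ℂ => fderiv ℂ f (z0 + ζ • v)) 0 := by
    have h1 : ContDiffOn ℂ 1 (fun ζ : ℂ => fderiv ℂ f (z0 + ζ • v)) (ball 0 r) := by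
      rw [contDiffOn_clm_apply]
      intro w
      exact (hFw w).contDiffOn isOpen_ball
    exact (h1.differentiableOn one_ne_zero).differentiableAt (isOpen_ball.mem_nhds (mem_ball_self hr0))
  set D := deriv (fun ζ : ℂ => fderiv ℂ f (z0 + ζ • v)) 0 with hDdef
  have hDer : HasFDerivAt (fun z => fderiv ℂ f z v) D z0 := by
    rw [hasFDerivAt_iff_isLittleO_nhds_zero]
    have hbig : (fun w : E => fderiv ℂ f (z0 + w) v - fderiv ℂ f z0 v - D w) =O[𝓝 0] fun w => ‖w‖ ^ 2 := by
      apply IsBigO.of_bound (L2 / (r / 2))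
      filter_upwards [ball_mem_nhds (0:E) hR] with w hw
      have hw : ‖w‖ < R := by simpa using hw
      let ρ : ℂ → F := fun ζ => f (z0 + w + ζ • v) - f (z0 + ζ • v) - fderiv ℂ f (z0 + ζ • v) w
      have hcomm : ∀ ζ : ℂ, z0 + w + ζ • v = z0 + ζ • v + w := fun ζ => by abel
      have hder : HasDerivAt ρ (fderiv ℂ f (z0 + w) v - fderiv ℂ f z0 v - D w) 0 := by
        have e0 : z0 + (0:ℂ) • v ∈ U := by simpa using hz0
        have e1 : z0 + w + (0:ℂ) • v ∈ U := by
          rw [hcomm]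
          exact hU4 (h34 (h23 (hadd _ (hζ 0 (mem_ball_self hr0)) _ hw)))
        have d1 := holo_line hU hf (z0 + w) v 0 e1
        have d2 := holo_line hU hf z0 v 0 e0
        have d3 := (hD.hasDerivAt).clm_apply (hasDerivAt_const (0:ℂ) w)
        have := (d1.fun_sub d2).fun_sub d3
        simp only [zero_smul, add_zero, map_zero] at this
        exact this
      have hdiff : DifferentiableOn ℂ ρ (ball 0 r) := by
        intro ζ hζm
        apply DifferentiableWithinAt.sub
        · apply DifferentiableAt.differentiableWithinAt
          apply DifferentiableAt.sub
          · have : z0 + w + ζ • v ∈ U := by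
              rw [hcomm]; exact hU4 (h34 (h23 (hadd _ (hζ ζ hζm) _ hw)))
            exact (holo_line hU hf (z0 + w) v ζ this).differentiableAt
          · exact (holo_line hU hf z0 v ζ (hU4 (h34 (h23 (h12 (hζ ζ hζm)))))).differentiableAt
        · exact hFw w ζ hζm
      have h1 : ‖deriv ρ 0‖ ≤ L2 * ‖w‖ ^ 2 / (r / 2) := by
        apply Complex.norm_deriv_le_of_forall_mem_sphere_norm_le (by positivity)
        · apply DifferentiableOn.diffContOnCl
          rw [closure_ball _ (by positivity)]
          exact hdiff.mono (closedBall_subset_ball (by linarith))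
        · intro ζ hζm
          have hζb : ζ ∈ ball (0:ℂ) r := by
            rw [mem_ball]; rw [mem_sphere] at hζm; linarith
          have := hTay _ (h12 (hζ ζ hζb)) w (hadd _ (hζ ζ hζb) _ hw)
          simp only [ρ]
          rw [hcomm]
          exact this
      rw [hder.deriv] at h1
      refine h1.trans (le_of_eq ?_)
      rw [norm_pow, norm_norm]; ring
    have h3 : (fun w : E => ‖w‖ ^ 2) =o[𝓝 0] fun w : E => w := isLittleO_norm_pow_id one_lt_two
    exact hbig.trans_isLittleO h3
  exact hDer.differentiableAt

theorem holo_contDiffOn [FiniteDimensional ℂ E] [CompleteSpace F] {U : Set E} (hU : IsOpen U)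
    (n : ℕ) : ∀ {f : E → F}, DifferentiableOn ℂ f U → ContDiffOn ℂ n f U := by
  induction n with
  | zero => intro f hf; exact contDiffOn_zero.mpr hf.continuousOn
  | succ n ih =>
    intro f hf
    push_cast
    rw [contDiffOn_succ_iff_fderiv_of_isOpen hU]
    refine ⟨hf, by simp, ?_⟩
    rw [contDiffOn_clm_apply]
    intro v
    exact ih (holo_fderiv_apply hU hf v)

end
end

/- part Taylor -/
section
section
open Metric Asymptotics Filter Topology

def monoSet (n : ℕ) : Set (ℂ × ℂ → ℂ) := {f | ∃ i l, i + l < n ∧ f = fun y => y.1 ^ i * y.2 ^ l}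

lemma radial_prim (n : ℕ) (P : ℂ × ℂ → ℂ) (hP : P ∈ Submodule.span ℂ (monoSet n)) :
    (∃ Q ∈ Submodule.span ℂ (monoSet (n+1)), ∀ (y : ℂ × ℂ) (s : ℂ),
      HasDerivAt (fun s : ℂ => Q (s • y)) (y.1 * P (s • y)) s) ∧
    (∃ Q ∈ Submodule.span ℂ (monoSet (n+1)), ∀ (y : ℂ × ℂ) (s : ℂ),
      HasDerivAt (fun s : ℂ => Q (s • y)) (y.2 * P (s • y)) s) := by
  have key : ∀ (i l k : ℕ), i + l = k + 1 → ∀ (y : ℂ × ℂ) (s : ℂ),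
      HasDerivAt (fun s : ℂ => (((k:ℂ) + 1)⁻¹ • fun y : ℂ × ℂ => y.1 ^ i * y.2 ^ l) (s • y))
        (s ^ k * (y.1 ^ i * y.2 ^ l)) s := by
    intro i l k h y s
    have h1 := ((hasDerivAt_pow (k+1) s).mul_const (y.1 ^ i * y.2 ^ l)).const_mul ((k:ℂ) + 1)⁻¹
    have hk : (k:ℂ) + 1 ≠ 0 := Nat.cast_add_one_ne_zero k
    convert! h1 using 1
    · funext s
      simp only [Pi.smul_apply, Prod.smul_fst, Prod.smul_snd, smul_eq_mul, mul_pow]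
      rw [← h, pow_add]; ring
    · push_cast
      field_simp
  constructor
  · induction hP using Submodule.span_induction with
    | mem f hf =>
      obtain ⟨i, l, hil, rfl⟩ := hf
      refine ⟨_, Submodule.smul_mem _ (((i + l : ℕ) : ℂ) + 1)⁻¹ (Submodule.subset_span ⟨i+1, l, by omega, rfl⟩), fun y s => ?_⟩
      convert! key (i+1) l (i+l) (by omega) y s using 1
      simp only [Prod.smul_fst, Prod.smul_snd, smul_eq_mul, mul_pow]
      ring
    | zero => exact ⟨0, zero_mem _, fun y s => by simpa using hasDerivAt_const s (0:ℂ)⟩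
    | add f g _ _ hf hg =>
      obtain ⟨Q1, h1, h1'⟩ := hf
      obtain ⟨Q2, h2, h2'⟩ := hg
      refine ⟨Q1 + Q2, add_mem h1 h2, fun y s => ?_⟩
      convert! (h1' y s).add (h2' y s) using 1
      simp only [Pi.add_apply]; ring
    | smul c f _ hf =>
      obtain ⟨Q1, h1, h1'⟩ := hf
      refine ⟨c • Q1, Submodule.smul_mem _ c h1, fun y s => ?_⟩
      convert! (h1' y s).const_mul c using 1
      simp only [Pi.smul_apply, smul_eq_mul]; ring
  · induction hP using Submodule.span_induction with
    | mem f hf =>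
      obtain ⟨i, l, hil, rfl⟩ := hf
      refine ⟨_, Submodule.smul_mem _ (((i + l : ℕ) : ℂ) + 1)⁻¹ (Submodule.subset_span ⟨i, l+1, by omega, rfl⟩), fun y s => ?_⟩
      convert! key i (l+1) (i+l) (by omega) y s using 1
      simp only [Prod.smul_fst, Prod.smul_snd, smul_eq_mul, mul_pow]
      ring
    | zero => exact ⟨0, zero_mem _, fun y s => by simpa using hasDerivAt_const s (0:ℂ)⟩
    | add f g _ _ hf hg =>
      obtain ⟨Q1, h1, h1'⟩ := hf
      obtain ⟨Q2, h2, h2'⟩ := hg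
      refine ⟨Q1 + Q2, add_mem h1 h2, fun y s => ?_⟩
      convert! (h1' y s).add (h2' y s) using 1
      simp only [Pi.add_apply]; ring
    | smul c f _ hf =>
      obtain ⟨Q1, h1, h1'⟩ := hf
      refine ⟨c • Q1, Submodule.smul_mem _ c h1, fun y s => ?_⟩
      convert! (h1' y s).const_mul c using 1
      simp only [Pi.smul_apply, smul_eq_mul]; ring

theorem taylor2 (n : ℕ) : ∀ (F : ℂ × ℂ → ℂ) (U : Set (ℂ × ℂ)), IsOpen U → (0 : ℂ × ℂ) ∈ U →
    DifferentiableOn ℂ F U → ∃ P ∈ Submodule.span ℂ (monoSet n),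
      (fun y => F y - P y) =O[𝓝 0] fun y => ‖y‖ ^ n := by
  induction n with
  | zero =>
    intro F U hU h0 hF
    refine ⟨0, zero_mem _, ?_⟩
    have : ContinuousAt F 0 := (hF.differentiableAt (hU.mem_nhds h0)).continuousAt
    simpa using this.tendsto.isBigO_one ℝ
  | succ n ih =>
    intro F U hU h0 hF
    obtain ⟨P1, hP1, hO1⟩ := ih _ U hU h0 (holo_fderiv_apply hU hF (1,0))
    obtain ⟨P2, hP2, hO2⟩ := ih _ U hU h0 (holo_fderiv_apply hU hF (0,1))
    obtain ⟨Q1, hQ1, hd1⟩ := (radial_prim n P1 hP1).1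
    obtain ⟨Q2, hQ2, hd2⟩ := (radial_prim n P2 hP2).2
    let P : ℂ × ℂ → ℂ := (Q1 + Q2) + (F 0 - (Q1 0 + Q2 0)) • (fun y => y.1 ^ 0 * y.2 ^ 0)
    refine ⟨P, add_mem (add_mem hQ1 hQ2) (Submodule.smul_mem _ _ (Submodule.subset_span ⟨0, 0, by omega, rfl⟩)), ?_⟩
    obtain ⟨C1, hC1⟩ := hO1.bound
    obtain ⟨C2, hC2⟩ := hO2.bound
    obtain ⟨δ, hδ, hb⟩ := Metric.eventually_nhds_iff_ball.mp ((hC1.and hC2).and (hU.mem_nhds h0))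
    apply IsBigO.of_bound (|C1| + |C2|)
    filter_upwards [ball_mem_nhds (0 : ℂ × ℂ) hδ] with y hy
    have hsy : ∀ s ∈ Set.Icc (0:ℝ) 1, ‖(s:ℂ) • y‖ ≤ ‖y‖ := by
      intro s hs
      rw [norm_smul, Complex.norm_real, Real.norm_eq_abs, abs_of_nonneg hs.1]
      exact mul_le_of_le_one_left (norm_nonneg _) hs.2
    have hsm : ∀ s ∈ Set.Icc (0:ℝ) 1, (s:ℂ) • y ∈ ball (0 : ℂ × ℂ) δ := by
      intro s hs
      rw [mem_ball_zero_iff] at hy ⊢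
      exact (hsy s hs).trans_lt hy
    have hder : ∀ s ∈ Set.Icc (0:ℝ) 1, HasDerivAt (fun s : ℝ => F ((s:ℂ) • y) - (Q1 ((s:ℂ) • y) + Q2 ((s:ℂ) • y)))
        (y.1 * (fderiv ℂ F ((s:ℂ) • y) (1,0) - P1 ((s:ℂ) • y)) + y.2 * (fderiv ℂ F ((s:ℂ) • y) (0,1) - P2 ((s:ℂ) • y))) s := by
      intro s hs
      have a1 := holo_line hU hF 0 y s (by rw [zero_add]; exact (hb _ (hsm s hs)).2)
      have a2 := (a1.fun_sub ((hd1 y s).fun_add (hd2 y s))).comp_ofReal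
      simp only [zero_add] at a2
      convert! a2 using 1
      have : y = y.1 • ((1:ℂ),(0:ℂ)) + y.2 • ((0:ℂ),(1:ℂ)) := by ext <;> simp
      have h2 : ∀ A : ℂ × ℂ →L[ℂ] ℂ, A y = y.1 * A (1,0) + y.2 * A (0,1) := by
        intro A
        conv_lhs => rw [this]
        simp only [map_add, map_smul, smul_eq_mul]
      rw [h2]; ring
    have hbd := norm_image_sub_le_of_norm_deriv_le_segment_01' (f := fun s : ℝ => F ((s:ℂ) • y) - (Q1 ((s:ℂ) • y) + Q2 ((s:ℂ) • y)))
      (C := (|C1| + |C2|) * ‖y‖ ^ (n+1)) (fun s hs => (hder s hs).hasDerivWithinAt) (by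
        intro s hs
        have hs : s ∈ Set.Icc (0:ℝ) 1 := ⟨hs.1, hs.2.le⟩
        have b1 := (hb _ (hsm s hs)).1.1
        have b2 := (hb _ (hsm s hs)).1.2
        rw [norm_pow, norm_norm] at b1 b2
        have hp : ‖(s:ℂ) • y‖ ^ n ≤ ‖y‖ ^ n := pow_le_pow_left₀ (norm_nonneg _) (hsy s hs) n
        have c1 : ‖fderiv ℂ F ((s:ℂ) • y) (1,0) - P1 ((s:ℂ) • y)‖ ≤ |C1| * ‖y‖ ^ n :=
          b1.trans (mul_le_mul (le_abs_self _) hp (by positivity) (abs_nonneg _))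
        have c2 : ‖fderiv ℂ F ((s:ℂ) • y) (0,1) - P2 ((s:ℂ) • y)‖ ≤ |C2| * ‖y‖ ^ n :=
          b2.trans (mul_le_mul (le_abs_self _) hp (by positivity) (abs_nonneg _))
        refine (norm_add_le _ _).trans ?_
        rw [norm_mul, norm_mul]
        have e1 : ‖y.1‖ ≤ ‖y‖ := norm_fst_le y
        have e2 : ‖y.2‖ ≤ ‖y‖ := norm_snd_le y
        calc _ ≤ ‖y‖ * (|C1| * ‖y‖ ^ n) + ‖y‖ * (|C2| * ‖y‖ ^ n) := by gcongr
          _ = _ := by ring)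
    simp only [Complex.ofReal_one, one_smul, Complex.ofReal_zero, zero_smul] at hbd
    rw [norm_pow, norm_norm]
    convert! hbd using 2
    simp only [P, Pi.add_apply, Pi.smul_apply, pow_zero, smul_eq_mul]
    ring

theorem taylor2' (m : ℕ) (F : ℂ × ℂ → ℂ) (U : Set (ℂ × ℂ)) (hU : IsOpen U) (h0 : (0 : ℂ × ℂ) ∈ U)
    (hF : DifferentiableOn ℂ F U) : ∃ c : Fin (m+1) × Fin (m+1) → ℂ,
      (fun y => F y - ∑ i, c i * (y.1 ^ (i.1 : ℕ) * y.2 ^ (i.2 : ℕ))) =O[𝓝 0] fun y => ‖y‖ ^ (m+1) := by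
  obtain ⟨P, hP, hO⟩ := taylor2 (m+1) F U hU h0 hF
  have : P ∈ Submodule.span ℂ (Set.range fun i : Fin (m+1) × Fin (m+1) => fun y : ℂ × ℂ => y.1 ^ (i.1 : ℕ) * y.2 ^ (i.2 : ℕ)) := by
    refine Submodule.span_mono ?_ hP
    rintro f ⟨i, l, h, rfl⟩
    exact ⟨(⟨i, by omega⟩, ⟨l, by omega⟩), rfl⟩
  obtain ⟨c, rfl⟩ := (Submodule.mem_span_range_iff_exists_fun ℂ).mp this
  refine ⟨c, ?_⟩
  simpa [Finset.sum_apply] using hO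

end
end

/- part Curve -/
section
section
open Metric Asymptotics Filter Topology

noncomputable def crvA (t : Fin 3 → ℝ) : ℝ := (1 - sq3 t) * (1 + sq3 t)⁻¹
noncomputable def crvB (i : Fin 3) (t : Fin 3 → ℝ) : ℝ := 2 * t i * (1 + sq3 t)⁻¹
/-- rational parametrization of the three-sphere near `(1,0)`, shifted to the origin -/
noncomputable def crvY (t : Fin 3 → ℝ) : ℂ × ℂ := ((crvA t : ℂ) + crvB 0 t * Complex.I - 1, (crvB 1 t : ℂ) + crvB 2 t * Complex.I)

noncomputable def crvY' : (Fin 3 → ℝ) →L[ℝ] ℂ × ℂ :=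
  ((2 * Complex.I) • (Complex.ofRealCLM.comp (ContinuousLinearMap.proj 0 : (Fin 3 → ℝ) →L[ℝ] ℝ))).prod
    ((2 : ℂ) • (Complex.ofRealCLM.comp (ContinuousLinearMap.proj 1 : (Fin 3 → ℝ) →L[ℝ] ℝ)) +
     (2 * Complex.I) • (Complex.ofRealCLM.comp (ContinuousLinearMap.proj 2 : (Fin 3 → ℝ) →L[ℝ] ℝ)))

lemma crvY'_apply (t) : crvY' t = (2 * Complex.I * t 0, 2 * (t 1 + t 2 * Complex.I)) := by
  ext <;> simp [crvY'] <;> ring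

lemma crvY_zero : crvY 0 = 0 := by
  simp [crvY, crvA, crvB, sq3]

lemma crvY_norm (t) : ‖1 + (crvY t).1‖ ^ 2 + ‖(crvY t).2‖ ^ 2 = 1 := by
  rw [← Complex.normSq_eq_norm_sq, ← Complex.normSq_eq_norm_sq]
  have h : 1 + sq3 t ≠ 0 := by linarith [sq3_nonneg t] |> fun h : 0 < 1 + sq3 t => h.ne'
  simp [Complex.normSq_apply, crvY, crvA, crvB]
  field_simp
  simp only [sq3]; ring

lemma crvY_deriv : HasFDerivAt crvY crvY' 0 := by
  have hp : ∀ i : Fin 3, HasFDerivAt (fun t : Fin 3 → ℝ => t i) (ContinuousLinearMap.proj i : (Fin 3 → ℝ) →L[ℝ] ℝ) 0 :=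
    fun i => (ContinuousLinearMap.proj i : (Fin 3 → ℝ) →L[ℝ] ℝ).hasFDerivAt
  have hs : HasFDerivAt sq3 (0 : (Fin 3 → ℝ) →L[ℝ] ℝ) 0 := by
    convert! (((hp 0).pow 2).add ((hp 1).pow 2)).add ((hp 2).pow 2) using 1
    ext t; simp
  have hs1 : HasFDerivAt (fun t => 1 + sq3 t) (0 : (Fin 3 → ℝ) →L[ℝ] ℝ) 0 := hs.const_add 1
  have h0 : sq3 0 = 0 := by simp [sq3]
  have hu : HasFDerivAt (fun t => (1 + sq3 t)⁻¹) (0 : (Fin 3 → ℝ) →L[ℝ] ℝ) 0 := by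
    convert! (hasDerivAt_inv (x := 1 + sq3 0) (by simp [h0])).comp_hasFDerivAt 0 hs1 using 1
    simp
  have hA : HasFDerivAt crvA (0 : (Fin 3 → ℝ) →L[ℝ] ℝ) 0 := by
    convert! (hs.const_sub 1).mul hu using 1
    ext; simp
  have hB : ∀ i, HasFDerivAt (crvB i) ((2:ℝ) • (ContinuousLinearMap.proj i : (Fin 3 → ℝ) →L[ℝ] ℝ)) 0 := by
    intro i
    convert! ((hp i).const_mul 2).mul hu using 1
    ext; simp [h0]
  have hc : ∀ {f : (Fin 3 → ℝ) → ℝ} {f' : (Fin 3 → ℝ) →L[ℝ] ℝ}, HasFDerivAt f f' 0 → HasFDerivAt (fun t => (f t : ℂ)) (Complex.ofRealCLM.comp f') 0 :=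
    fun h => Complex.ofRealCLM.hasFDerivAt.comp 0 h
  have h1 := (((hc hA).fun_add ((hc (hB 0)).mul_const Complex.I)).sub_const 1).prodMk ((hc (hB 1)).fun_add ((hc (hB 2)).mul_const Complex.I))
  convert! h1 using 1
  ext t <;> simp [crvY'] <;> ring

lemma crvY_isBigO : crvY =O[𝓝 0] fun t => ‖t‖ := by
  have h := crvY_deriv.isBigO_sub
  simpa [crvY_zero] using h.norm_right

variable {K : IntermediateField ℚ ℝ} {m : ℕ}

lemma JC.ofReal {u : (Fin 3 → ℝ) → ℝ} (h : JR K m u) : JC K m fun t => (u t : ℂ) :=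
  ⟨by simpa using h, by simpa using JR.const (zero_mem K)⟩

lemma crvB_JR (i) : JR K m (crvB i) :=
  ((JR.const (by exact_mod_cast (natCast_mem K 2))).mul (JR.coord i)).mul inv_JR

lemma crvA_JR : JR K m crvA := ((JR.const (one_mem K)).sub sq3_JR).mul inv_JR

lemma JC.I : JC K m fun _ => Complex.I := JC.const (by simpa using zero_mem K) (by simpa using one_mem K)

lemma crvY_JC1 : JC K m fun t => (crvY t).1 :=
  ((JC.ofReal crvA_JR).add ((JC.ofReal (crvB_JR 0)).mul JC.I)).sub JC.one
lemma crvY_JC2 : JC K m fun t => (crvY t).2 :=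
  (JC.ofReal (crvB_JR 1)).add ((JC.ofReal (crvB_JR 2)).mul JC.I)

lemma comp_JC (F : ℂ × ℂ → ℂ) (c : Fin (m+1) × Fin (m+1) → ℂ)
    (hc : ∀ i, (c i).re ∈ K ∧ (c i).im ∈ K)
    (hO : (fun y => F y - ∑ i, c i * (y.1 ^ (i.1 : ℕ) * y.2 ^ (i.2 : ℕ))) =O[𝓝 0] fun y => ‖y‖ ^ (m+1)) :
    JC K m fun t => F (crvY t) := by
  have h1 : JC K m fun t => ∑ i, c i * ((crvY t).1 ^ (i.1 : ℕ) * (crvY t).2 ^ (i.2 : ℕ)) :=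
    JC.sum _ fun i _ => (JC.const (hc i).1 (hc i).2).mul ((crvY_JC1.pow _).mul (crvY_JC2.pow _))
  refine h1.of_isBigO ?_
  have hT : Tendsto crvY (𝓝 0) (𝓝 0) := by
    have := crvY_deriv.continuousAt.tendsto
    rwa [crvY_zero] at this
  refine (hO.comp_tendsto hT).trans ?_
  exact (crvY_isBigO.norm_left.pow (m+1))

end
end

/- part CaseA -/
noncomputable section
open Metric Asymptotics Filter Topology

variable {N : ℕ}

/-- real coordinates -/
def rc (s : Fin (N+1) × Bool) (x : Cn (N+1)) : ℝ := if s.2 then (x s.1).re else (x s.1).im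

def rcL : Cn (N+1) →L[ℝ] (Fin (N+1) × Bool → ℝ) :=
  LinearMap.toContinuousLinearMap
  { toFun := fun x s => rc s x
    map_add' := by intro x y; ext s; simp only [rc, Pi.add_apply]; split_ifs <;> simp
    map_smul' := by intro c x; ext s; simp only [rc, Pi.smul_apply, RingHom.id_apply]; split_ifs <;> simp }

lemma rcL_apply (x : Cn (N+1)) (s) : rcL x s = rc s x := rfl

lemma rcL_inj (x : Cn (N+1)) (h : rcL x = 0) : x = 0 := by
  ext j
  have h1 := congrFun h (j, true)
  have h2 := congrFun h (j, false)
  simp [rcL_apply, rc] at h1 h2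
  exact Complex.ext h1 h2

/-- the linear functional `h` -/
def hfun (e : Cn N) (x : Cn (N+1)) : ℂ := ∑ k : Fin N, (starRingEnd ℂ) (e k) * x k.castSucc

def psi (p e : Cn N) (j : Fin N) (x : Cn (N+1)) : ℂ :=
  x j.castSucc + (starRingEnd ℂ) (x (Fin.last N)) * hfun e x ^ 2 * p j

def rho0 (p e : Cn N) (x : Cn (N+1)) : ℝ := ∑ j, ‖psi p e j x‖ ^ 2 - 1

def phi (x : Cn (N+1)) : ℝ := ((x (Fin.last N)).re * (x (Fin.last N)).im) ^ 2

def bpoly {S : Finset (Fin (N+1) × Bool →₀ ℕ)} (β : S → ℝ) (x : Cn (N+1)) : ℝ :=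
  ∑ μ : S, β μ * ∏ s, rc s x ^ (μ.1 s)

def rho {S : Finset (Fin (N+1) × Bool →₀ ℕ)} (p e : Cn N) (β : S → ℝ) (x : Cn (N+1)) : ℝ :=
  rho0 p e x + phi x * bpoly β x

set_option maxHeartbeats 800000 in
theorem caseA (r : ℕ) (hr : 2 * ((N+1)*((3*r+1)*(3*r+1)) + (N + N)) < (r+1)^3) (p e : Cn N)
    {S : Finset (Fin (N+1) × Bool →₀ ℕ)} (hS : ∀ d : Fin (N+1) × Bool →₀ ℕ, d.degree ≤ 3 * r → d ∈ S)
    (β : S → ℝ) (hβ : AlgebraicIndependent ℚ β)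
    (H : Cn N → Cn (N+1)) (Ω : Set (Cn N)) (hΩ : IsOpen Ω) (hH : DifferentiableOn ℂ H Ω)
    (z0 a : Cn N) (hz0 : z0 ∈ Ω) (hz1 : ‖z0‖ = 1) (ha : ‖a‖ = 1) (hza : inner ℂ z0 a = 0)
    (hind : ∀ u v : ℂ, u • fderiv ℂ H z0 z0 + v • fderiv ℂ H z0 a = 0 → u = 0 ∧ v = 0)
    (hphi : phi (H z0) ≠ 0) (hzero : ∀ z ∈ Ω, ‖z‖ = 1 → rho p e β (H z) = 0) : False := by
  set m := 3 * r with hm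
  let Kf : ℂ × ℂ → Cn N := fun y => z0 + (y.1 • z0 + y.2 • a)
  have hKd : Differentiable ℂ Kf := by intro y; fun_prop
  have hU : IsOpen (Kf ⁻¹' Ω) := hΩ.preimage hKd.continuous
  have h0U : (0 : ℂ × ℂ) ∈ Kf ⁻¹' Ω := by simpa [Kf] using hz0
  have hFd : ∀ j, DifferentiableOn ℂ (fun y => H (Kf y) j) (Kf ⁻¹' Ω) := by
    intro j
    have h1 : DifferentiableOn ℂ (fun y => H (Kf y)) (Kf ⁻¹' Ω) :=
      hH.comp hKd.differentiableOn (fun y hy => hy)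
    have h2 := (EuclideanSpace.proj j : Cn (N+1) →L[ℂ] ℂ).differentiable
    exact h2.comp_differentiableOn h1
  choose c hc using fun j => taylor2' m (fun y => H (Kf y) j) _ hU h0U (hFd j)
  let κ : (Fin (N+1) × (Fin (m+1) × Fin (m+1))) ⊕ (Fin N ⊕ Fin N) → ℂ :=
    Sum.elim (fun i => c i.1 i.2) (Sum.elim (fun j => p j) (fun j => e j))
  let J : Set ℝ := Set.range fun i : Bool × ((Fin (N+1) × (Fin (m+1) × Fin (m+1))) ⊕ (Fin N ⊕ Fin N)) =>
    if i.1 then (κ i.2).re else (κ i.2).im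
  have hJ : J.Finite := Set.finite_range _
  have hJn : J.ncard ≤ 2 * ((N+1)*((3*r+1)*(3*r+1)) + (N + N)) := by
    have := Set.ncard_image_le (f := fun i : Bool × ((Fin (N+1) × (Fin (m+1) × Fin (m+1))) ⊕ (Fin N ⊕ Fin N)) =>
      if i.1 then (κ i.2).re else (κ i.2).im) (s := Set.univ) Set.finite_univ
    rw [Set.image_univ] at this
    refine this.trans (le_of_eq ?_)
    simp [Set.ncard_univ, hm]
  set K := IntermediateField.adjoin ℚ J with hK
  have hκ : ∀ i, (κ i).re ∈ K ∧ (κ i).im ∈ K := fun i =>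
    ⟨IntermediateField.subset_adjoin ℚ J ⟨(true, i), by simp⟩,
     IntermediateField.subset_adjoin ℚ J ⟨(false, i), by simp⟩⟩
  let G : (Fin 3 → ℝ) → Cn (N+1) := fun t => H (Kf (crvY t))
  have hG : ∀ j, JC K m fun t => G t j := fun j =>
    comp_JC (fun y => H (Kf y) j) (c j) (fun i => hκ (Sum.inl (j, i))) (hc j)
  have hp : ∀ j, JC K m fun _ => p j := fun j => JC.const (hκ (Sum.inr (Sum.inl j))).1 (hκ (Sum.inr (Sum.inl j))).2
  have he : ∀ j, JC K m fun _ => e j := fun j => JC.const (hκ (Sum.inr (Sum.inr j))).1 (hκ (Sum.inr (Sum.inr j))).2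
  have hh : JC K m fun t => hfun e (G t) := JC.sum _ fun k _ => (he k).conj.mul (hG _)
  have hpsi : ∀ j, JC K m fun t => psi p e j (G t) := fun j =>
    (hG _).add ((((hG _).conj).mul (hh.pow 2)).mul (hp j))
  have hF0 : JR K m fun t => rho0 p e (G t) :=
    (JR.sum _ fun j _ => (hpsi j).normSq).sub (JR.const (one_mem K))
  have hUU : JR K m fun t => phi (G t) := ((hG (Fin.last N)).1.mul (hG (Fin.last N)).2).pow 2
  have hX : ∀ s, JR K m fun t => rc s (G t) := by
    rintro ⟨j, b⟩
    cases b
    · simpa [rc] using (hG j).2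
    · simpa [rc] using (hG j).1
  -- derivative
  have hG0 : G 0 = H z0 := by simp [G, Kf, crvY_zero]
  have hK0 : Kf (crvY 0) = z0 := by simp [Kf, crvY_zero]
  let Kf' : ℂ × ℂ →L[ℝ] Cn N := ((ContinuousLinearMap.fst ℂ ℂ ℂ).smulRight z0 + (ContinuousLinearMap.snd ℂ ℂ ℂ).smulRight a).restrictScalars ℝ
  have hKf' : HasFDerivAt Kf Kf' (crvY 0) :=
    (((ContinuousLinearMap.fst ℂ ℂ ℂ).smulRight z0 + (ContinuousLinearMap.snd ℂ ℂ ℂ).smulRight a).restrictScalars ℝ).hasFDerivAt.const_add z0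
  have hHd : HasFDerivAt H ((fderiv ℂ H z0).restrictScalars ℝ) (Kf (crvY 0)) := by
    rw [hK0]
    exact (hH.differentiableAt (hΩ.mem_nhds hz0)).hasFDerivAt.restrictScalars ℝ
  have hGd : HasFDerivAt G (((fderiv ℂ H z0).restrictScalars ℝ).comp (Kf'.comp crvY')) 0 :=
    hHd.comp 0 (hKf'.comp 0 crvY_deriv)
  have hXd : HasFDerivAt (fun t s => rc s (G t)) (rcL.comp (((fderiv ℂ H z0).restrictScalars ℝ).comp (Kf'.comp crvY'))) 0 :=
    rcL.hasFDerivAt.comp 0 hGd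
  have hinj : Function.Injective (rcL.comp (((fderiv ℂ H z0).restrictScalars ℝ).comp (Kf'.comp crvY'))) := by
    rw [injective_iff_map_eq_zero]
    intro t ht
    have h1 := rcL_inj _ ht
    have h2 : (2 * Complex.I * t 0) • fderiv ℂ H z0 z0 + (2 * (t 1 + t 2 * Complex.I)) • fderiv ℂ H z0 a = 0 := by
      simpa [Kf', crvY'_apply] using h1
    obtain ⟨e1, e2⟩ := hind _ _ h2
    have e1 : (t 0 : ℂ) = 0 := by simpa using e1
    have e2 : (t 1 + t 2 * Complex.I : ℂ) = 0 := by simpa using e2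
    have e3 := congrArg Complex.re e2
    have e4 := congrArg Complex.im e2
    simp at e1 e3 e4
    funext i
    fin_cases i
    · exact e1
    · exact e3
    · exact e4
  have hGc : ContinuousAt G 0 := hGd.continuousAt
  have hphic : Continuous (phi : Cn (N+1) → ℝ) := by unfold phi; fun_prop
  refine jet_core S r _ m hm hS hr β hβ J hJ hJn (fun s t => rc s (G t)) (fun t => phi (G t)) (fun t => rho0 p e (G t))
    hX hUU hF0 (hphic.continuousAt.comp hGc) (by simpa [hG0] using hphi) _ hXd hinj ?_
  have hcont : ContinuousAt (fun t => Kf (crvY t)) 0 := (hKf'.comp 0 crvY_deriv).continuousAt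
  have hev : ∀ᶠ t in 𝓝 0, Kf (crvY t) ∈ Ω := hcont.eventually (hΩ.mem_nhds (by simpa [hK0] using hz0))
  filter_upwards [hev] with t ht
  have hn : ‖Kf (crvY t)‖ = 1 := by
    have e1 : Kf (crvY t) = (1 + (crvY t).1) • z0 + (crvY t).2 • a := by
      simp only [Kf]; rw [add_smul, one_smul, add_assoc]
    have e2 := norm_add_sq_eq_norm_sq_add_norm_sq_of_inner_eq_zero (𝕜 := ℂ) ((1 + (crvY t).1) • z0) ((crvY t).2 • a)
      (by rw [inner_smul_left, inner_smul_right, hza]; simp)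
    rw [← e1, norm_smul, norm_smul, hz1, ha, mul_one, mul_one] at e2
    have e3 := crvY_norm t
    have e4 : ‖Kf (crvY t)‖ ^ 2 = 1 := by rw [← e3, sq, sq, sq]; exact e2
    exact (pow_eq_one_iff_of_nonneg (norm_nonneg _) two_ne_zero).mp e4
  exact hzero _ ht hn

end

/- part CB1 -/
noncomputable section
open Metric Asymptotics Filter Topology
open scoped ContDiff

variable {N : ℕ}

def Sm {F : Type*} [NormedAddCommGroup F] [NormedSpace ℝ F] (p : Cn N) (g : Cn N → F) : Prop :=
  ∀ᶠ z in 𝓝 p, ContDiffAt ℝ ∞ g z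

/-- real inner product -/
lemma circle_norm (z w : Cn N) (hz : ‖z‖ = 1) (hw : ‖w‖ = 1) (h : (inner ℂ z w).re = 0) (t : ℝ) :
    ‖(Real.cos t : ℂ) • z + (Real.sin t : ℂ) • w‖ = 1 := by
  have h2 : ‖(Real.cos t : ℂ) • z + (Real.sin t : ℂ) • w‖ ^ 2 = 1 := by
    rw [@norm_add_sq ℂ, inner_smul_left, inner_smul_right, norm_smul, norm_smul, hz, hw]
    simp only [Complex.norm_real, Complex.conj_ofReal]
    have : RCLike.re ((Real.cos t : ℂ) * ((Real.sin t : ℂ) * inner ℂ z w)) = 0 := by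
      simp [h]
    rw [this]
    simp
  exact (pow_eq_one_iff_of_nonneg (norm_nonneg _) two_ne_zero).mp h2

lemma circle_deriv (z w : Cn N) : HasDerivAt (fun t : ℝ => (Real.cos t : ℂ) • z + (Real.sin t : ℂ) • w) w 0 := by
  have h1 := ((Real.hasDerivAt_cos 0).ofReal_comp.smul_const z).fun_add ((Real.hasDerivAt_sin 0).ofReal_comp.smul_const w)
  simpa using h1

lemma kills_tangent {F : Type*} [NormedAddCommGroup F] [NormedSpace ℝ F] (u : Cn N → F) (z : Cn N)
    (hz : ‖z‖ = 1) (hu : DifferentiableAt ℝ u z) (h0 : ∀ᶠ x in 𝓝 z, ‖x‖ = 1 → u x = 0) (v : Cn N)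
    (hv : (inner ℂ z v).re = 0) : fderiv ℝ u z v = 0 := by
  by_cases hv0 : v = 0
  · simp [hv0]
  set w : Cn N := ((‖v‖⁻¹ : ℝ) : ℂ) • v with hw
  have hvn : ‖v‖ ≠ 0 := norm_ne_zero_iff.mpr hv0
  have hwn : ‖w‖ = 1 := by
    rw [hw, norm_smul, Complex.norm_real, norm_inv, norm_norm, inv_mul_cancel₀ hvn]
  have hwi : (inner ℂ z w).re = 0 := by rw [hw, inner_smul_right, Complex.re_ofReal_mul, hv, mul_zero]
  have hc := circle_deriv z w
  have hc0 : (Real.cos 0 : ℂ) • z + (Real.sin 0 : ℂ) • w = z := by simp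
  have h1 : HasDerivAt (fun t : ℝ => u ((Real.cos t : ℂ) • z + (Real.sin t : ℂ) • w)) (fderiv ℝ u z w) 0 := by
    have : HasFDerivAt u (fderiv ℝ u z) ((Real.cos 0 : ℂ) • z + (Real.sin 0 : ℂ) • w) := by
      rw [hc0]; exact hu.hasFDerivAt
    exact this.comp_hasDerivAt 0 hc
  have h2 : (fun t : ℝ => u ((Real.cos t : ℂ) • z + (Real.sin t : ℂ) • w)) =ᶠ[𝓝 0] fun _ => 0 := by
    have := hc.continuousAt.tendsto
    rw [hc0] at this
    filter_upwards [this.eventually h0] with t ht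
    exact ht (circle_norm z w hz hwn hwi t)
  have h3 : fderiv ℝ u z w = 0 := h1.unique ((hasDerivAt_const (0:ℝ) (0:F)).congr_of_eventuallyEq h2)
  have h4 : v = ‖v‖ • w := by
    rw [hw, ← Complex.coe_smul, smul_smul, ← Complex.ofReal_mul, mul_inv_cancel₀ hvn]; simp
  rw [h4, map_smul, h3, smul_zero]

lemma normal_form {F : Type*} [NormedAddCommGroup F] [NormedSpace ℝ F] (A : Cn N →L[ℝ] F) (z : Cn N)
    (hz : ‖z‖ = 1) (h : ∀ v : Cn N, (inner ℂ z v).re = 0 → A v = 0) (v : Cn N) :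
    A v = (inner ℂ z v).re • A z := by
  have h1 := h (v - (inner ℂ z v).re • z) (by
    rw [← Complex.coe_smul, inner_sub_right, inner_smul_right, inner_self_eq_norm_sq_to_K, hz]; simp)
  rw [map_sub, map_smul, sub_eq_zero] at h1
  exact h1

lemma inner_cbasis (z : Cn N) (j : Fin N) (c : ℂ) : inner ℂ z (cbasis j c) = c * (starRingEnd ℂ) (z j) := by
  simp [cbasis, EuclideanSpace.inner_single_right]

lemma wirtDBarR_normSq (z : Cn N) (j : Fin N) : wirtDBarR (fun z : Cn N => ‖z‖ ^ 2 - 1) z j = z j := by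
  have h : HasFDerivAt (fun z : Cn N => ‖z‖ ^ 2 - 1) (2 • (innerSL ℝ z)) z :=
    (hasStrictFDerivAt_norm_sq z).hasFDerivAt.sub_const 1
  have hin : ∀ v : Cn N, inner ℝ z v = (inner ℂ z v).re := fun v => by
    simp [PiLp.inner_apply, Complex.inner]
  simp only [wirtDBarR, h.fderiv]
  simp [hin, inner_cbasis]
  apply Complex.ext <;> simp <;> ring

lemma cr_kills {M : Set (Cn N)} (hM : M = {z : Cn N | ‖z‖ = 1}) {p : Cn N} (L : CRVectorField M p)
    (u : Cn N → ℂ) (hu : ∀ᶠ z in 𝓝 p, DifferentiableAt ℝ u z) (h0 : ∀ᶠ z in 𝓝 p, z ∈ M → u z = 0) :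
    ∀ᶠ z in 𝓝 p, z ∈ M → L.apply u z = 0 := by
  obtain ⟨V, hV, hpV, hL⟩ := L.tangent (fun z => ‖z‖ ^ 2 - 1) Set.univ isOpen_univ trivial
    (by
      have : AnalyticOnNhd ℝ (fun z : Cn N => ‖z‖ ^ 2) Set.univ := by
        exact contDiff_omega_iff_analyticOnNhd.mp (contDiff_norm_sq (E := Cn N) ℝ)
      intro z hz
      exact (this z hz).sub analyticAt_const) (by
      rintro z ⟨hz, -⟩
      rw [hM] at hz
      have : ‖z‖ = 1 := hz
      simp [this])
  filter_upwards [hV.mem_nhds hpV, hu, h0.eventually_nhds] with z hzV hzu hz0 hzM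
  have hL := hL z ⟨hzM, hzV⟩
  have hz : ‖z‖ = 1 := by rw [hM] at hzM; exact hzM
  simp only [wirtDBarR_normSq] at hL
  have hk := normal_form (fderiv ℝ u z) z hz (fun v hv => kills_tangent u z hz hzu (by
    filter_upwards [hz0] with x hx hx1
    exact hx (by rw [hM]; exact hx1)) v hv)
  have hw : ∀ j, wirtDBar u z j = (fderiv ℝ u z z) / 2 * z j := by
    intro j
    simp only [wirtDBar]
    rw [hk (cbasis j 1), hk (cbasis j Complex.I), inner_cbasis, inner_cbasis]
    simp
    conv_rhs => rw [← Complex.re_add_im (z j)]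
    ring
  simp only [CRVectorField.apply, hw]
  rw [← mul_zero ((fderiv ℝ u z z) / 2), ← hL, Finset.mul_sum]
  exact Finset.sum_congr rfl fun j _ => by ring

lemma Sm.diff {F : Type*} [NormedAddCommGroup F] [NormedSpace ℝ F] {p : Cn N} {g : Cn N → F} (h : Sm p g) :
    ∀ᶠ z in 𝓝 p, DifferentiableAt ℝ g z := by
  filter_upwards [h] with z hz
  exact hz.differentiableAt (by simp)

lemma sm_apply {M : Set (Cn N)} {p : Cn N} (L : CRVectorField M p) {g : Cn N → ℂ} (hg : Sm p g) :
    Sm p (L.apply g) := by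
  unfold Sm
  filter_upwards [hg, L.isOpen.mem_nhds L.mem] with z hz hzL
  unfold CRVectorField.apply
  apply ContDiffAt.sum
  intro j _
  apply ContDiffAt.mul
  · exact (L.analytic j z hzL).contDiffAt
  · have h1 : ContDiffAt ℝ ∞ (fderiv ℝ g) z := hz.fderiv_right (by simp)
    unfold wirtDBar
    have h2 : ∀ v : Cn N, ContDiffAt ℝ ∞ (fun z => fderiv ℝ g z v) z := fun v => h1.clm_apply contDiffAt_const
    exact contDiffAt_const.mul ((h2 _).add (contDiffAt_const.mul (h2 _)))

lemma sm_list {M : Set (Cn N)} {p : Cn N} (Ls : List (CRVectorField M p)) {g : Cn N → ℂ} (hg : Sm p g) :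
    Sm p (CRApplyList Ls g) := by
  induction Ls with
  | nil => exact hg
  | cons L Ls ih => exact sm_apply L ih

lemma wirtDBar_mul_holo {g h : Cn N → ℂ} {z : Cn N} (hg : DifferentiableAt ℝ g z) (hh : DifferentiableAt ℂ h z) (j) :
    wirtDBar (fun z => g z * h z) z j = wirtDBar g z j * h z := by
  have hh' := hh.hasFDerivAt.restrictScalars ℝ
  simp only [wirtDBar]
  rw [(hg.hasFDerivAt.fun_mul hh').fderiv]
  have : fderiv ℂ h z (cbasis j Complex.I) = Complex.I * fderiv ℂ h z (cbasis j 1) := by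
    rw [← smul_eq_mul, ← map_smul]; congr 1; ext i; simp [cbasis, EuclideanSpace.single_apply]
  simp [this]
  ring_nf
  simp

lemma wirtDBar_sum {ι : Type*} (s : Finset ι) {g : ι → Cn N → ℂ} {z : Cn N} (hg : ∀ i ∈ s, DifferentiableAt ℝ (g i) z) (j) :
    wirtDBar (fun z => ∑ i ∈ s, g i z) z j = ∑ i ∈ s, wirtDBar (g i) z j := by
  simp only [wirtDBar]
  rw [fderiv_fun_sum hg]
  simp [Finset.mul_sum, Finset.sum_add_distrib, mul_add]

lemma cr_list_pair {M : Set (Cn N)} (hM : M = {z : Cn N | ‖z‖ = 1}) {p : Cn N} (Ls : List (CRVectorField M p))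
    {n : ℕ} (g h : Fin n → Cn N → ℂ) (hg : ∀ i, Sm p (g i)) (hh : ∀ i, ∀ᶠ z in 𝓝 p, DifferentiableAt ℂ (h i) z)
    (h0 : ∀ᶠ z in 𝓝 p, z ∈ M → ∑ i, g i z * h i z = 0) :
    ∀ᶠ z in 𝓝 p, z ∈ M → ∑ i, CRApplyList Ls (g i) z * h i z = 0 := by
  induction Ls with
  | nil => exact h0
  | cons L Ls ih =>
    have hd : ∀ᶠ z in 𝓝 p, ∀ i, DifferentiableAt ℝ (CRApplyList Ls (g i)) z ∧ DifferentiableAt ℂ (h i) z :=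
      eventually_all.mpr fun i => (sm_list Ls (hg i)).diff.and (hh i)
    have h1 := cr_kills hM L _ (by
      filter_upwards [hd] with z hz
      exact DifferentiableAt.fun_sum fun i _ => (hz i).1.mul ((hz i).2.restrictScalars ℝ)) ih
    filter_upwards [h1, hd] with z hz hzd hzM
    rw [← hz hzM]
    have e1 : ∀ j, wirtDBar (fun z => ∑ i, CRApplyList Ls (g i) z * h i z) z j = ∑ i, wirtDBar (CRApplyList Ls (g i)) z j * h i z := by
      intro j
      rw [wirtDBar_sum Finset.univ (g := fun i z => CRApplyList Ls (g i) z * h i z) (fun i _ => (hzd i).1.mul ((hzd i).2.restrictScalars ℝ))]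
      exact Finset.sum_congr rfl fun i _ => wirtDBar_mul_holo (hzd i).1 (hzd i).2 j
    have e2 : L.apply (fun z => ∑ i, CRApplyList Ls (g i) z * h i z) z = ∑ j, ∑ i, L.coeff z j * (wirtDBar (CRApplyList Ls (g i)) z j * h i z) := by
      simp only [CRVectorField.apply, e1, Finset.mul_sum]
    rw [e2, Finset.sum_comm]
    refine Finset.sum_congr rfl fun i _ => ?_
    change L.apply (CRApplyList Ls (g i)) z * h i z = _
    simp only [CRVectorField.apply, Finset.sum_mul]
    exact Finset.sum_congr rfl fun j _ => by ring

end

/- part CB2 -/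
noncomputable section
open Metric Asymptotics Filter Topology
open scoped ContDiff

variable {N : ℕ}

lemma fderiv_wirtD {n : ℕ} (f : Cn n → ℝ) (q v : Cn n) : fderiv ℝ f q v = 2 * (∑ j, wirtD f q j * v j).re := by
  have hv : v = ∑ j, ((v j).re • cbasis j (1:ℂ) + (v j).im • cbasis j Complex.I) := by
    ext i
    simp [cbasis, Finset.sum_add_distrib, Pi.single_apply]
  conv_lhs => rw [hv]
  rw [map_sum, Complex.re_sum, Finset.mul_sum]
  refine Finset.sum_congr rfl fun j _ => ?_
  rw [map_add, map_smul, map_smul]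
  simp [wirtD]
  ring

lemma pair_zero {n : ℕ} (f : Cn n → ℝ) (q : Cn n) (A : Cn N →L[ℂ] Cn n) (h : ∀ v, fderiv ℝ f q (A v) = 0) (v : Cn N) :
    ∑ j, wirtD f q j * (A v) j = 0 := by
  have h1 := h v
  have h2 := h (Complex.I • v)
  rw [fderiv_wirtD] at h1 h2
  have h3 : ∑ j, wirtD f q j * (A (Complex.I • v)) j = Complex.I * ∑ j, wirtD f q j * (A v) j := by
    rw [Finset.mul_sum]; refine Finset.sum_congr rfl fun j _ => ?_
    simp; ring
  rw [h3] at h2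
  apply Complex.ext
  · simpa using h1
  · simpa using h2

/-- if `dH` kills the complex tangent space along the sphere near `z0`, it vanishes on `z0` -/
lemma levi_kill {H : Cn N → Cn (N+1)} {Ω : Set (Cn N)} (hΩ : IsOpen Ω) (hH : DifferentiableOn ℂ H Ω)
    {z0 a : Cn N} (hz0 : z0 ∈ Ω) (hz : ‖z0‖ = 1) (ha : ‖a‖ = 1) (hza : inner ℂ z0 a = 0)
    (hk : ∀ᶠ z in 𝓝 z0, ‖z‖ = 1 → ∀ v : Cn N, inner ℂ z v = 0 → fderiv ℂ H z v = 0) :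
    fderiv ℂ H z0 z0 = 0 := by
  have hC2 : ContDiffOn ℂ 2 H Ω := by exact_mod_cast holo_contDiffOn hΩ 2 hH
  have hdd : DifferentiableAt ℂ (fderiv ℂ H) z0 :=
    ((hC2.contDiffAt (hΩ.mem_nhds hz0)).fderiv_right (m := 1) (by norm_num)).differentiableAt (by simp)
  have haz : inner ℂ a z0 = 0 := by rw [← inner_conj_symm, hza]; simp
  have hzz : inner ℂ z0 z0 = (1:ℂ) := by rw [inner_self_eq_norm_sq_to_K, hz]; simp
  have haa : inner ℂ a a = (1:ℂ) := by rw [inner_self_eq_norm_sq_to_K, ha]; simp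
  have key : ∀ b : ℂ, ‖b‖ = 1 → fderiv ℂ (fderiv ℂ H) z0 (b • a) a = fderiv ℂ H z0 ((starRingEnd ℂ) b • z0) := by
    intro b hb
    have hbb : b * (starRingEnd ℂ) b = 1 := by rw [Complex.mul_conj, Complex.normSq_eq_norm_sq, hb]; simp
    have hw : ‖b • a‖ = 1 := by rw [norm_smul, hb, ha, one_mul]
    have hwi : (inner ℂ z0 (b • a)).re = 0 := by rw [inner_smul_right, hza]; simp
    have hc := circle_deriv z0 (b • a)
    have hc0 : (Real.cos 0 : ℂ) • z0 + (Real.sin 0 : ℂ) • (b • a) = z0 := by simp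
    have hc2 := circle_deriv a ((-(starRingEnd ℂ) b) • z0)
    have h1 : HasDerivAt (fun t : ℝ => fderiv ℂ H ((Real.cos t : ℂ) • z0 + (Real.sin t : ℂ) • (b • a))) (fderiv ℂ (fderiv ℂ H) z0 (b • a)) 0 := by
      have : HasFDerivAt (fderiv ℂ H) ((fderiv ℂ (fderiv ℂ H) z0).restrictScalars ℝ) ((Real.cos 0 : ℂ) • z0 + (Real.sin 0 : ℂ) • (b • a)) := by
        rw [hc0]; exact hdd.hasFDerivAt.restrictScalars ℝ
      exact this.comp_hasDerivAt 0 hc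
    have h2 : HasDerivAt (fun t : ℝ => fderiv ℂ H ((Real.cos t : ℂ) • z0 + (Real.sin t : ℂ) • (b • a))
        ((Real.cos t : ℂ) • a + (Real.sin t : ℂ) • ((-(starRingEnd ℂ) b) • z0)))
        (fderiv ℂ (fderiv ℂ H) z0 (b • a) a + fderiv ℂ H z0 ((-(starRingEnd ℂ) b) • z0)) 0 := by
      have hR : HasDerivAt (fun t : ℝ => (fderiv ℂ H ((Real.cos t : ℂ) • z0 + (Real.sin t : ℂ) • (b • a))).restrictScalars ℝ) ((fderiv ℂ (fderiv ℂ H) z0 (b • a)).restrictScalars ℝ) 0 :=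
        (ContinuousLinearMap.restrictScalarsL ℂ (Cn N) (Cn (N+1)) ℝ ℝ).hasFDerivAt.comp_hasDerivAt 0 h1
      have := hR.clm_apply hc2
      simpa using this
    have h3 : (fun t : ℝ => fderiv ℂ H ((Real.cos t : ℂ) • z0 + (Real.sin t : ℂ) • (b • a))
        ((Real.cos t : ℂ) • a + (Real.sin t : ℂ) • ((-(starRingEnd ℂ) b) • z0))) =ᶠ[𝓝 0] fun _ => 0 := by
      have := hc.continuousAt.tendsto
      rw [hc0] at this
      filter_upwards [this.eventually hk] with t ht
      apply ht (circle_norm z0 (b • a) hz hw hwi t)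
      simp only [inner_add_left, inner_add_right, inner_smul_left, inner_smul_right, hza, haz, hzz, haa, Complex.conj_ofReal]
      ring
    have h4 := h2.unique ((hasDerivAt_const (0:ℝ) (0 : Cn (N+1))).congr_of_eventuallyEq h3)
    rw [neg_smul, map_neg, ← sub_eq_add_neg, sub_eq_zero] at h4
    exact h4
  have k1 := key 1 (by simp)
  have k2 := key Complex.I (by simp)
  simp only [one_smul, map_one] at k1
  simp only [Complex.conj_I, neg_smul, map_neg, map_smul, ContinuousLinearMap.smul_apply, k1] at k2
  have k3 : (2 * Complex.I) • fderiv ℂ H z0 z0 = 0 := by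
    rw [mul_smul, two_smul]; nth_rewrite 1 [k2]; simp
  simpa using k3

/-- existence of a unit vector orthogonal to `z` -/
lemma exists_orth (hN : 2 ≤ N) (z : Cn N) : ∃ a : Cn N, ‖a‖ = 1 ∧ inner ℂ z a = 0 := by
  have h1 : Module.finrank ℂ (ℂ ∙ z) + Module.finrank ℂ (ℂ ∙ z)ᗮ = N := by
    rw [Submodule.finrank_add_finrank_orthogonal]; simp
  have h2 : Module.finrank ℂ (ℂ ∙ z) ≤ 1 := by
    simpa using finrank_span_le_card (R := ℂ) ({z} : Set (Cn N))
  have h3 : 0 < Module.finrank ℂ (ℂ ∙ z)ᗮ := by omega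
  obtain ⟨⟨x, hx⟩, hx0⟩ := (Module.finrank_pos_iff_exists_ne_zero).mp h3
  have hx0 : x ≠ 0 := fun h => hx0 (by ext1; exact h)
  have hzx : inner ℂ z x = 0 := (Submodule.mem_orthogonal_singleton_iff_inner_right).mp hx
  refine ⟨((‖x‖⁻¹ : ℝ) : ℂ) • x, ?_, ?_⟩
  · rw [norm_smul, Complex.norm_real, norm_inv, norm_norm, inv_mul_cancel₀ (norm_ne_zero_iff.mpr hx0)]
  · rw [inner_smul_right, hzx, mul_zero]

def NoIndep (H : Cn N → Cn (N+1)) (z : Cn N) : Prop :=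
  ∀ a : Cn N, ‖a‖ = 1 → inner ℂ z a = 0 → ∃ u v : ℂ, u • fderiv ℂ H z z + v • fderiv ℂ H z a = 0 ∧ ¬ (u = 0 ∧ v = 0)

lemma du_zero (hN : 2 ≤ N) {H : Cn N → Cn (N+1)} {Ω : Set (Cn N)} (hΩ : IsOpen Ω) (hH : DifferentiableOn ℂ H Ω)
    (hno : ∀ z ∈ Ω, ‖z‖ = 1 → NoIndep H z) (f : Cn (N+1) → ℝ) (hf : ∀ z ∈ Ω, ContDiffAt ℝ 1 f (H z))
    (h0 : ∀ z ∈ Ω, ‖z‖ = 1 → f (H z) = 0) (z0 : Cn N) (hz0 : z0 ∈ Ω) (hz1 : ‖z0‖ = 1) (v : Cn N) :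
    fderiv ℝ f (H z0) (fderiv ℂ H z0 v) = 0 := by
  have hHd : ∀ z ∈ Ω, HasFDerivAt H ((fderiv ℂ H z).restrictScalars ℝ) z := fun z hz =>
    (hH.differentiableAt (hΩ.mem_nhds hz)).hasFDerivAt.restrictScalars ℝ
  have hu : ∀ z ∈ Ω, HasFDerivAt (fun z => f (H z)) ((fderiv ℝ f (H z)).comp ((fderiv ℂ H z).restrictScalars ℝ)) z :=
    fun z hz => ((hf z hz).differentiableAt (by simp)).hasFDerivAt.comp z (hHd z hz)
  have hkt : ∀ z ∈ Ω, ‖z‖ = 1 → ∀ v : Cn N, (inner ℂ z v).re = 0 → fderiv ℝ f (H z) (fderiv ℂ H z v) = 0 := by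
    intro z hz hz1 v hv
    have := kills_tangent (fun z => f (H z)) z hz1 (hu z hz).differentiableAt (by
      filter_upwards [hΩ.mem_nhds hz] with x hx hx1 using h0 x hx hx1) v hv
    rw [(hu z hz).fderiv] at this
    simpa using this
  have hnf : fderiv ℝ f (H z0) (fderiv ℂ H z0 v) = (inner ℂ z0 v).re • fderiv ℝ f (H z0) (fderiv ℂ H z0 z0) :=
    normal_form ((fderiv ℝ f (H z0)).comp ((fderiv ℂ H z0).restrictScalars ℝ)) z0 hz1 (fun v hv => hkt z0 hz0 hz1 v hv) v
  rw [hnf]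
  by_contra hne
  have hne : fderiv ℝ f (H z0) (fderiv ℂ H z0 z0) ≠ 0 := by
    intro h; apply hne; rw [h, smul_zero]
  obtain ⟨a, ha, hza⟩ := exists_orth hN z0
  have hC1 : ContDiffOn ℂ 1 H Ω := by exact_mod_cast holo_contDiffOn hΩ 1 hH
  have hcont : ContinuousAt (fun z => fderiv ℝ f (H z) (fderiv ℂ H z z)) z0 := by
    have c1 : ContinuousAt (fun z => fderiv ℝ f (H z)) z0 :=
      ContinuousAt.comp (f := H) (g := fderiv ℝ f) ((hf z0 hz0).fderiv_right (m := 0) (by norm_num)).continuousAt (hHd z0 hz0).continuousAt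
    have c2 : ContinuousAt (fderiv ℂ H) z0 :=
      ((hC1.contDiffAt (hΩ.mem_nhds hz0)).fderiv_right (m := 0) (by norm_num)).continuousAt
    exact c1.clm_apply (c2.clm_apply continuousAt_id)
  have hk : ∀ᶠ z in 𝓝 z0, ‖z‖ = 1 → ∀ v : Cn N, inner ℂ z v = 0 → fderiv ℂ H z v = 0 := by
    filter_upwards [hcont.eventually_ne hne, hΩ.mem_nhds hz0] with z hz hzΩ hz1
    have unit : ∀ a : Cn N, ‖a‖ = 1 → inner ℂ z a = 0 → fderiv ℂ H z a = 0 := by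
      intro a ha hza
      obtain ⟨u, v, huv, hn⟩ := hno z hzΩ hz1 a ha hza
      have hV0 : fderiv ℂ H z z ≠ 0 := by intro h; rw [h] at hz; simp at hz
      have hv : v ≠ 0 := by
        rintro rfl
        apply hn
        rw [zero_smul, add_zero] at huv
        exact ⟨(smul_eq_zero.mp huv).resolve_right hV0, rfl⟩
      obtain ⟨c, hc⟩ : ∃ c : ℂ, fderiv ℂ H z a = c • fderiv ℂ H z z := by
        refine ⟨-(v⁻¹ * u), ?_⟩
        rw [neg_smul, mul_smul, eq_neg_of_add_eq_zero_left huv, smul_neg, inv_smul_smul₀ hv, neg_neg]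
      have e1 : fderiv ℝ f (H z) (fderiv ℂ H z (Complex.I • z)) = 0 := hkt z hzΩ hz1 _ (by
        rw [inner_smul_right, inner_self_eq_norm_sq_to_K, hz1]; simp)
      have e2 : fderiv ℝ f (H z) (fderiv ℂ H z a) = 0 := hkt z hzΩ hz1 _ (by rw [hza]; simp)
      have e3 : fderiv ℝ f (H z) (fderiv ℂ H z (Complex.I • a)) = 0 := hkt z hzΩ hz1 _ (by
        rw [inner_smul_right, hza]; simp)
      rw [map_smul] at e1 e3
      have ec : ∀ d : ℂ, d • fderiv ℂ H z z = d.re • fderiv ℂ H z z + d.im • (Complex.I • fderiv ℂ H z z) := by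
        intro d
        rw [← Complex.coe_smul, ← Complex.coe_smul, smul_smul, ← add_smul, Complex.re_add_im]
      have hre : c.re = 0 := by
        rw [hc, ec, map_add, map_smul, map_smul, e1] at e2
        simpa [hz] using e2
      have him : c.im = 0 := by
        rw [hc, smul_smul, ec, map_add, map_smul, map_smul, e1] at e3
        simpa [hz] using e3
      rw [hc, show c = 0 from Complex.ext hre him, zero_smul]
    intro v hv
    by_cases hv0 : v = 0
    · simp [hv0]
    have hvn := norm_ne_zero_iff.mpr hv0
    have := unit (((‖v‖⁻¹ : ℝ) : ℂ) • v) (by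
      rw [norm_smul, Complex.norm_real, norm_inv, norm_norm, inv_mul_cancel₀ hvn]) (by rw [inner_smul_right, hv, mul_zero])
    rw [map_smul] at this
    exact (smul_eq_zero.mp this).resolve_left (by simpa using hvn)
  have := levi_kill hΩ hH hz0 hz1 ha hza hk
  rw [this] at hne; simp at hne

end

/- part CB3 -/
noncomputable section
open Metric Asymptotics Filter Topology
open scoped ContDiff

variable {N : ℕ}

lemma sm_wirt {p : Cn N} {H : Cn N → Cn (N+1)} (hH : Sm p H) (hHc : ContinuousAt H p) (f : Cn (N+1) → ℝ) (U' : Set (Cn (N+1)))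
    (hU' : IsOpen U') (hp : H p ∈ U') (hf : AnalyticOnNhd ℝ f U') (j) : 
    Sm p (fun z => wirtD f (H z) j) ∧ ∀ᶠ z in 𝓝 p, ContDiffAt ℝ ∞ (fun q => wirtD f q j) (H z) := by
  have hC : ∀ q ∈ U', ContDiffAt ℝ ∞ (fun q => wirtD f q j) q := by
    intro q hq
    have h1 : ContDiffAt ℝ ∞ (fderiv ℝ f) q := ((hf q hq).contDiffAt (n := ∞)).fderiv_right (by simp)
    have h2 : ∀ v : Cn (N+1), ContDiffAt ℝ ∞ (fun q => ((fderiv ℝ f q v : ℝ) : ℂ)) q := fun v =>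
      Complex.ofRealCLM.contDiff.contDiffAt.comp q (h1.clm_apply contDiffAt_const)
    unfold wirtD
    exact contDiffAt_const.mul ((h2 _).sub (contDiffAt_const.mul (h2 _)))
  have hev : ∀ᶠ z in 𝓝 p, H z ∈ U' := hHc.eventually (hU'.mem_nhds hp)
  constructor
  · unfold Sm
    filter_upwards [hH, hev] with z hz hzU
    exact (hC _ hzU).comp z hz
  · filter_upwards [hev] with z hzU using hC _ hzU

lemma list_zero {M : Set (Cn N)} (hM : M = {z : Cn N | ‖z‖ = 1}) {p : Cn N} (Ls : List (CRVectorField M p)) (hLs : Ls ≠ [])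
    (g : Cn N → ℂ) (hg : Sm p g) (hd : ∀ᶠ z in 𝓝 p, z ∈ M → fderiv ℝ g z = 0) :
    ∀ᶠ z in 𝓝 p, z ∈ M → CRApplyList Ls g z = 0 := by
  induction Ls with
  | nil => exact absurd rfl hLs
  | cons L Ls ih =>
    by_cases h : Ls = []
    · subst h
      filter_upwards [hd] with z hz hzM
      change L.apply g z = 0
      simp [CRVectorField.apply, wirtDBar, hz hzM]
    · exact cr_kills hM L _ (sm_list Ls hg).diff (ih h)

theorem caseB (hN : 2 ≤ N) {M : Set (Cn N)} (hM : M = {z : Cn N | ‖z‖ = 1}) {p : Cn N} (hp : p ∈ M)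
    (M' : Set (Cn (N+1))) (ℓ : ℕ) {H : Cn N → Cn (N+1)} {Ω : Set (Cn N)} (hΩ : IsOpen Ω) (hpΩ : p ∈ Ω) (hH : DifferentiableOn ℂ H Ω)
    (hHM : ∀ z ∈ M ∩ Ω, H z ∈ M') (hno : ∀ z ∈ Ω, ‖z‖ = 1 → NoIndep H z)
    (w0 : Fin (N+1) → ℂ) (hprop : ∀ (f : Cn (N+1) → ℝ) (U' : Set (Cn (N+1))), IsOpen U' → H p ∈ U' → AnalyticOnNhd ℝ f U' →
      (∀ w ∈ M' ∩ U', f w = 0) → ∃ c : ℂ, wirtD f (H p) = c • w0)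
    (hfin : FinNondeg M p M' ℓ H) : False := by
  have hHC : ContDiffOn ℂ ∞ H Ω := contDiffOn_infty.mpr fun n => holo_contDiffOn hΩ n hH
  have hHs : Sm p H := by
    unfold Sm
    filter_upwards [hΩ.mem_nhds hpΩ] with z hz
    exact (hHC.contDiffAt (hΩ.mem_nhds hz)).restrict_scalars ℝ
  have hHc : ContinuousAt H p := (hH.differentiableAt (hΩ.mem_nhds hpΩ)).continuousAt
  have hmem : ∀ z, z ∈ M ↔ ‖z‖ = 1 := by intro z; rw [hM]; rfl
  -- step 1
  have step1 : ∀ (f : Cn (N+1) → ℝ) (U' : Set (Cn (N+1))), IsOpen U' → H p ∈ U' → AnalyticOnNhd ℝ f U' →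
      (∀ w ∈ M' ∩ U', f w = 0) → ∀ v : Cn N, ∀ᶠ z in 𝓝 p, z ∈ M → ∑ j, wirtD f (H z) j * (fderiv ℂ H z v) j = 0 := by
    intro f U' hU' hpU' hf hf0 v
    have hcO : ContinuousOn H Ω := hH.continuousOn
    have hΩ' : IsOpen (Ω ∩ H ⁻¹' U') := hcO.isOpen_inter_preimage hΩ hU'
    filter_upwards [hΩ'.mem_nhds ⟨hpΩ, hpU'⟩] with z hz hzM
    apply pair_zero
    intro v
    exact du_zero hN hΩ' (hH.mono Set.inter_subset_left) (fun z hz => hno z hz.1) f (fun z hz => (hf _ hz.2).contDiffAt)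
      (fun z hz hz1 => hf0 _ ⟨hHM z ⟨(hmem z).mpr hz1, hz.1⟩, hz.2⟩) z hz ((hmem z).mp hzM) v
  -- step 2 : dH = 0 on M near p
  obtain ⟨b, hbs, hbspan, hbli⟩ := exists_linearIndependent ℂ
    { v : Fin (N+1) → ℂ | ∃ (Ls : List (CRVectorField M p)) (ρ' : Cn (N+1) → ℝ) (U' : Set (Cn (N+1))),
        Ls.length ≤ ℓ ∧ IsOpen U' ∧ H p ∈ U' ∧ AnalyticOnNhd ℝ ρ' U' ∧
        (∀ w ∈ M' ∩ U', ρ' w = 0) ∧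
        v = fun j => CRApplyList Ls (fun z => wirtD ρ' (H z) j) p }
  have hfin' := hfin
  unfold FinNondeg at hfin
  rw [hfin] at hbspan
  let B : Module.Basis b ℂ (Fin (N+1) → ℂ) := Module.Basis.mk hbli (by rw [Subtype.range_coe, hbspan])
  let B' : Module.Basis (Fin (N+1)) ℂ (Fin (N+1) → ℂ) := B.reindex (B.indexEquiv (Pi.basisFun ℂ (Fin (N+1))))
  have hB' : ∀ k, B' k ∈ b := by
    intro k
    simp only [B', Module.Basis.reindex_apply, B, Module.Basis.mk_apply]
    exact Subtype.mem _
  choose Ls f U' hl hU' hpU' hf hf0 hv using fun k => hbs (hB' k)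
  let A : Cn N → Matrix (Fin (N+1)) (Fin (N+1)) ℂ := fun z => Matrix.of fun k j => CRApplyList (Ls k) (fun z => wirtD (f k) (H z) j) z
  have hsm : ∀ k j, Sm p (fun z => wirtD (f k) (H z) j) := fun k j => (sm_wirt hHs hHc (f k) (U' k) (hU' k) (hpU' k) (hf k) j).1
  have hAc : ContinuousAt (fun z => (A z).det) p := by
    have : ContinuousAt A p := by
      apply continuousAt_pi.mpr; intro k; apply continuousAt_pi.mpr; intro j
      exact ((sm_list (Ls k) (hsm k j)).self_of_nhds).continuousAt
    exact (Continuous.matrix_det continuous_id).continuousAt.comp this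
  have hA0 : (A p).det ≠ 0 := by
    have : LinearIndependent ℂ (A p).row := by
      convert! B'.linearIndependent using 1
      funext k
      rw [hv k]; rfl
    exact (((A p).isUnit_iff_isUnit_det).mp (Matrix.linearIndependent_rows_iff_isUnit.mp this)).ne_zero
  have hann : ∀ (v : Cn N) (k), ∀ᶠ z in 𝓝 p, z ∈ M → ∑ j, A z k j * (fderiv ℂ H z v) j = 0 := by
    intro v k
    refine cr_list_pair hM (Ls k) (fun j z => wirtD (f k) (H z) j) (fun j z => (fderiv ℂ H z v) j) (hsm k) ?_
      (step1 (f k) (U' k) (hU' k) (hpU' k) (hf k) (hf0 k) v)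
    intro j
    filter_upwards [hΩ.mem_nhds hpΩ] with z hz
    have h1 := (holo_fderiv_apply hΩ hH v).differentiableAt (hΩ.mem_nhds hz)
    exact (EuclideanSpace.proj j : Cn (N+1) →L[ℂ] ℂ).differentiableAt.comp z h1
  have hdHv : ∀ v : Cn N, ∀ᶠ z in 𝓝 p, z ∈ M → fderiv ℂ H z v = 0 := by
    intro v
    filter_upwards [eventually_all.mpr (hann v), hAc.eventually_ne hA0] with z hz hdet hzM
    have : (A z).mulVec (fun j => (fderiv ℂ H z v) j) = 0 := by
      funext k
      exact hz k hzM
    have := Matrix.eq_zero_of_mulVec_eq_zero hdet this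
    ext j
    exact congrFun this j
  have hdH : ∀ᶠ z in 𝓝 p, z ∈ M → fderiv ℂ H z = 0 := by
    filter_upwards [eventually_all.mpr fun i : Fin N => hdHv (EuclideanSpace.basisFun (Fin N) ℂ i)] with z hz hzM
    have : (fderiv ℂ H z : Cn N →ₗ[ℂ] Cn (N+1)) = 0 :=
      (EuclideanSpace.basisFun (Fin N) ℂ).toBasis.ext fun i => by simpa using hz i hzM
    ext1 v
    exact LinearMap.congr_fun this v
  -- step 3
  have hle : (⊤ : Submodule ℂ (Fin (N+1) → ℂ)) ≤ Submodule.span ℂ {w0} := by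
    rw [← hfin, Submodule.span_le]
    rintro v ⟨Ls, f, U', -, hU', hpU', hf, hf0, rfl⟩
    by_cases hL : Ls = []
    · subst hL
      obtain ⟨c, hc⟩ := hprop f U' hU' hpU' hf hf0
      have : (fun j => CRApplyList ([] : List (CRVectorField M p)) (fun z => wirtD f (H z) j) p) = c • w0 := by
        rw [← hc]; rfl
      rw [this]
      exact Submodule.smul_mem _ _ (Submodule.mem_span_singleton_self _)
    · have : (fun j => CRApplyList Ls (fun z => wirtD f (H z) j) p) = 0 := by
        funext j
        obtain ⟨s1, s2⟩ := sm_wirt hHs hHc f U' hU' hpU' hf j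
        refine (list_zero hM Ls hL _ s1 ?_).self_of_nhds hp
        filter_upwards [s2, hdH, hΩ.mem_nhds hpΩ] with z h1 h2 hzΩ hzM
        have hHd : HasFDerivAt H ((fderiv ℂ H z).restrictScalars ℝ) z :=
          (hH.differentiableAt (hΩ.mem_nhds hzΩ)).hasFDerivAt.restrictScalars ℝ
        have := ((h1.differentiableAt (by simp)).hasFDerivAt.comp z hHd).fderiv
        rw [h2 hzM] at this
        have e : fderiv ℝ (fun z => wirtD f (H z) j) z = fderiv ℝ ((fun q => wirtD f q j) ∘ H) z := rfl
        rw [e, this]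
        ext1 v; simp
      rw [this]
      exact zero_mem _
  have h1 : Module.finrank ℂ (Fin (N+1) → ℂ) ≤ 1 := by
    have h2 := Submodule.finrank_mono hle
    rw [finrank_top] at h2
    refine h2.trans ?_
    simpa using finrank_span_le_card (R := ℂ) ({w0} : Set (Fin (N+1) → ℂ))
  rw [Module.finrank_fin_fun] at h1
  omega

end

/- part Excl -/
noncomputable section
open Metric Asymptotics Filter Topology
open scoped ContDiff

variable {N : ℕ}

lemma coord_contDiff (j : Fin (N+1)) : ContDiff ℝ ω (fun x : Cn (N+1) => x j) :=
  ((EuclideanSpace.proj j : Cn (N+1) →L[ℂ] ℂ).restrictScalars ℝ).contDiff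

lemma conj_contDiff {f : Cn (N+1) → ℂ} (hf : ContDiff ℝ ω f) : ContDiff ℝ ω (fun x => (starRingEnd ℂ) (f x)) :=
  Complex.conjCLE.contDiff.comp hf

lemma re_contDiff {f : Cn (N+1) → ℂ} (hf : ContDiff ℝ ω f) : ContDiff ℝ ω (fun x => (f x).re) :=
  Complex.reCLM.contDiff.comp hf
lemma im_contDiff {f : Cn (N+1) → ℂ} (hf : ContDiff ℝ ω f) : ContDiff ℝ ω (fun x => (f x).im) :=
  Complex.imCLM.contDiff.comp hf

lemma hfun_contDiff (e : Cn N) : ContDiff ℝ ω (hfun e) := by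
  unfold hfun
  exact ContDiff.sum fun k _ => contDiff_const.mul (coord_contDiff _)

lemma psi_contDiff (p e : Cn N) (j) : ContDiff ℝ ω (psi p e j) := by
  unfold psi
  exact (coord_contDiff _).add (((conj_contDiff (coord_contDiff _)).mul ((hfun_contDiff e).pow 2)).mul contDiff_const)

lemma rho_contDiff {S : Finset (Fin (N+1) × Bool →₀ ℕ)} (p e : Cn N) (β : S → ℝ) : ContDiff ℝ ω (rho p e β) := by
  unfold rho rho0 phi bpoly
  refine ContDiff.add (ContDiff.sub (ContDiff.sum fun j _ => (psi_contDiff p e j).norm_sq ℝ) contDiff_const) ?_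
  refine ContDiff.mul (((re_contDiff (coord_contDiff _)).mul (im_contDiff (coord_contDiff _))).pow 2) ?_
  refine ContDiff.sum fun μ _ => contDiff_const.mul ?_
  refine contDiff_prod fun s _ => ContDiff.pow ?_ _
  unfold rc
  split_ifs
  · exact re_contDiff (coord_contDiff _)
  · exact im_contDiff (coord_contDiff _)

lemma wirtD_continuous {f : Cn (N+1) → ℝ} (hf : ContDiff ℝ ω f) : Continuous (wirtD f) := by
  have h1 : Continuous (fderiv ℝ f) := hf.continuous_fderiv (by simp)
  apply continuous_pi
  intro j
  unfold wirtD
  have h2 : ∀ v : Cn (N+1), Continuous fun q => ((fderiv ℝ f q v : ℝ) : ℂ) := fun v =>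
    Complex.continuous_ofReal.comp (h1.clm_apply continuous_const)
  exact continuous_const.mul ((h2 _).sub (continuous_const.mul (h2 _)))

def Mp (f : Cn (N+1) → ℝ) : Set (Cn (N+1)) := {x | wirtD f x ≠ 0 ∧ f x = 0}

lemma Mp_generic {f : Cn (N+1) → ℝ} (hf : ContDiff ℝ ω f) (q) (hq : q ∈ Mp f) : IsGenericAt (Mp f) 1 q := by
  refine ⟨hq, {x | wirtD f x ≠ 0}, fun z _ => f z, ?_, hq.1, ?_, ?_, ?_⟩
  · exact isOpen_ne_fun (wirtD_continuous hf) continuous_const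
  · intro k z hz
    exact contDiff_omega_iff_analyticOnNhd.mp hf z trivial
  · ext z; simp [Mp]; tauto
  · intro z hz
    exact linearIndependent_unique_iff.mpr hz.2

lemma Mp_mult {g : Cn (N+1) → ℝ} (hg : ContDiff ℝ ω g) (q) (hq : q ∈ Mp g)
    (f : Cn (N+1) → ℝ) (U' : Set (Cn (N+1))) (hU' : IsOpen U') (hqU : q ∈ U') (hf : AnalyticOnNhd ℝ f U')
    (hf0 : ∀ w ∈ Mp g ∩ U', f w = 0) : ∃ c : ℂ, wirtD f q = c • wirtD g q := by
  have hext : IsLocalExtrOn f {x | g x = g q} q := by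
    left
    have h1 : ∀ᶠ x in 𝓝 q, wirtD g x ≠ 0 := (wirtD_continuous hg).continuousAt.eventually_ne hq.1
    have h2 : ∀ᶠ x in 𝓝 q, x ∈ U' := hU'.mem_nhds hqU
    filter_upwards [h1.filter_mono nhdsWithin_le_nhds, h2.filter_mono nhdsWithin_le_nhds, self_mem_nhdsWithin] with x hx1 hx2 hx3
    have hx3 : g x = g q := hx3
    rw [hf0 x ⟨⟨hx1, hx3.trans hq.2⟩, hx2⟩, hf0 q ⟨hq, hqU⟩]
  obtain ⟨a, b, hab, heq⟩ := hext.exists_multipliers_of_hasStrictFDerivAt_1d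
    (hg.contDiffAt.hasStrictFDerivAt (by simp)) (((hf q hqU).contDiffAt (n := 1)).hasStrictFDerivAt (by simp))
  have hb : b ≠ 0 := by
    rintro rfl
    rw [zero_smul, add_zero] at heq
    have ha : a ≠ 0 := by rintro rfl; exact hab rfl
    have : fderiv ℝ g q = 0 := (smul_eq_zero.mp heq).resolve_left ha
    apply hq.1
    funext j; simp [wirtD, this]
  have hfg : fderiv ℝ f q = (-(b⁻¹ * a)) • fderiv ℝ g q := by
    rw [neg_smul, mul_smul, eq_neg_of_add_eq_zero_left heq, smul_neg, inv_smul_smul₀ hb, neg_neg]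
  refine ⟨((-(b⁻¹ * a) : ℝ) : ℂ), ?_⟩
  funext j
  simp only [wirtD, hfg, Pi.smul_apply, ContinuousLinearMap.smul_apply, smul_eq_mul, Complex.ofReal_mul]
  ring

theorem excl (hN : 2 ≤ N) {M : Set (Cn N)} (hM : M = {z : Cn N | ‖z‖ = 1}) {p : Cn N} (hp : p ∈ M) (e : Cn N)
    (r : ℕ) (hr : 2 * ((N+1)*((3*r+1)*(3*r+1)) + (N + N)) < (r+1)^3)
    {S : Finset (Fin (N+1) × Bool →₀ ℕ)} (hS : ∀ d : Fin (N+1) × Bool →₀ ℕ, d.degree ≤ 3 * r → d ∈ S)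
    (β : S → ℝ) (hβ : AlgebraicIndependent ℚ β) (ℓ : ℕ) (x : Cn (N+1)) (hx : x ∈ MappingLocus M p (Mp (rho p e β)) ℓ) :
    phi x = 0 := by
  by_contra hphi
  obtain ⟨hxM, Ω, H, hΩ, hpΩ, hH, hHp, hHM, hfin⟩ := hx
  have hphic : Continuous (phi : Cn (N+1) → ℝ) := by unfold phi; fun_prop
  have hΩ' : IsOpen (Ω ∩ H ⁻¹' {x | phi x ≠ 0}) := hH.continuousOn.isOpen_inter_preimage hΩ (isOpen_ne_fun hphic continuous_const)
  have hpΩ' : p ∈ Ω ∩ H ⁻¹' {x | phi x ≠ 0} := ⟨hpΩ, by simpa [hHp] using hphi⟩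
  have hHM' : ∀ z ∈ M ∩ (Ω ∩ H ⁻¹' {x | phi x ≠ 0}), H z ∈ Mp (rho p e β) := fun z hz => hHM z ⟨hz.1, hz.2.1⟩
  by_cases hno : ∀ z ∈ Ω ∩ H ⁻¹' {x | phi x ≠ 0}, ‖z‖ = 1 → NoIndep H z
  · refine caseB hN hM hp _ ℓ hΩ' hpΩ' (hH.mono Set.inter_subset_left) hHM' hno (wirtD (rho p e β) (H p)) ?_ hfin
    intro f U' hU' hpU' hf hf0
    exact Mp_mult (rho_contDiff p e β) (H p) (hHp ▸ hxM) f U' hU' hpU' hf hf0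
  · simp only [NoIndep] at hno
    push Not at hno
    obtain ⟨z0, hz0, hz1, a, ha, hza, hind⟩ := hno
    refine caseA r hr p e hS β hβ H _ hΩ' (hH.mono Set.inter_subset_left) z0 a hz0 hz1 ha hza hind hz0.2 ?_
    intro z hz hz1
    exact (hHM' z ⟨by rw [hM]; exact hz1, hz⟩).2

end

/- part Wirt -/
noncomputable section
open Metric Asymptotics Filter Topology
open scoped ContDiff

variable {N : ℕ}

lemma fderiv_line {f : Cn (N+1) → ℝ} {x v : Cn (N+1)} {d : ℝ} (hf : DifferentiableAt ℝ f x)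
    (h : HasDerivAt (fun t : ℝ => f (x + t • v)) d 0) : fderiv ℝ f x v = d := by
  have h1 : HasDerivAt (fun t : ℝ => x + t • v) v 0 := by
    simpa using ((hasDerivAt_id (0:ℝ)).smul_const v).const_add x
  have h2 : HasFDerivAt f (fderiv ℝ f x) (x + (0:ℝ) • v) := by simpa using hf.hasFDerivAt
  exact (h2.comp_hasDerivAt 0 h1).unique h

lemma hfun_add_smul (e : Cn N) (x v : Cn (N+1)) (t : ℝ) : hfun e (x + t • v) = hfun e x + t * hfun e v := by
  simp only [hfun, Finset.mul_sum, ← Finset.sum_add_distrib]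
  refine Finset.sum_congr rfl fun k _ => ?_
  simp; ring

lemma lin_deriv (a b : ℂ) : HasDerivAt (fun t : ℝ => a + (t:ℂ) * b) b 0 := by
  have := ((Complex.ofRealCLM.hasDerivAt (x := (0:ℝ))).mul_const b).const_add a
  simpa using this

lemma psi_line (p e : Cn N) (j : Fin N) (x v : Cn (N+1)) :
    HasDerivAt (fun t : ℝ => psi p e j (x + t • v))
      (v j.castSucc + ((starRingEnd ℂ) (v (Fin.last N)) * hfun e x ^ 2 + (starRingEnd ℂ) (x (Fin.last N)) * (2 * hfun e x * hfun e v)) * p j) 0 := by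
  have e1 : (fun t : ℝ => psi p e j (x + t • v)) = fun t : ℝ => (x j.castSucc + (t:ℂ) * v j.castSucc) +
      ((starRingEnd ℂ) (x (Fin.last N)) + (t:ℂ) * (starRingEnd ℂ) (v (Fin.last N))) * (hfun e x + (t:ℂ) * hfun e v) ^ 2 * p j := by
    funext t
    simp only [psi, hfun_add_smul]
    simp
  rw [e1]
  have h := (lin_deriv (x j.castSucc) (v j.castSucc)).fun_add
    (((lin_deriv ((starRingEnd ℂ) (x (Fin.last N))) ((starRingEnd ℂ) (v (Fin.last N)))).fun_mul
      ((lin_deriv (hfun e x) (hfun e v)).fun_pow 2)).mul_const (p j))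
  convert! h using 1
  simp

lemma rho_line {S : Finset (Fin (N+1) × Bool →₀ ℕ)} (p e : Cn N) (β : S → ℝ) (x v : Cn (N+1))
    (hx : (x (Fin.last N)).re * (x (Fin.last N)).im = 0) :
    fderiv ℝ (rho p e β) x v = ∑ j, 2 * ((starRingEnd ℂ) (psi p e j x) * (v j.castSucc + ((starRingEnd ℂ) (v (Fin.last N)) * hfun e x ^ 2 + (starRingEnd ℂ) (x (Fin.last N)) * (2 * hfun e x * hfun e v)) * p j)).re := by
  apply fderiv_line ((rho_contDiff p e β).differentiable (by simp) x)
  have h1 : HasDerivAt (fun t : ℝ => rho0 p e (x + t • v)) (∑ j, 2 * ((starRingEnd ℂ) (psi p e j x) * (v j.castSucc + ((starRingEnd ℂ) (v (Fin.last N)) * hfun e x ^ 2 + (starRingEnd ℂ) (x (Fin.last N)) * (2 * hfun e x * hfun e v)) * p j)).re) 0 := by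
    unfold rho0
    apply HasDerivAt.sub_const
    apply HasDerivAt.fun_sum
    intro j _
    convert! (psi_line p e j x v).norm_sq using 1
    simp [Complex.inner]
    ring
  have hb : ContDiff ℝ ω (bpoly β) := by
    unfold bpoly
    refine ContDiff.sum fun μ _ => contDiff_const.mul ?_
    refine contDiff_prod fun s _ => ContDiff.pow ?_ _
    unfold rc
    split_ifs
    · exact re_contDiff (coord_contDiff _)
    · exact im_contDiff (coord_contDiff _)
  have h2 : HasDerivAt (fun t : ℝ => phi (x + t • v) * bpoly β (x + t • v)) 0 0 := by
    have hl : DifferentiableAt ℝ (fun t : ℝ => x + t • v) 0 := by fun_prop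
    have hb1 : DifferentiableAt ℝ (fun t : ℝ => bpoly β (x + t • v)) 0 :=
      (hb.differentiable (by simp) _).comp 0 hl
    have hphi : HasDerivAt (fun t : ℝ => phi (x + t • v)) 0 0 := by
      have hc : ContDiff ℝ ω (fun x : Cn (N+1) => (x (Fin.last N)).re * (x (Fin.last N)).im) :=
        (re_contDiff (coord_contDiff _)).mul (im_contDiff (coord_contDiff _))
      have hd : DifferentiableAt ℝ (fun t : ℝ => ((x + t • v) (Fin.last N)).re * ((x + t • v) (Fin.last N)).im) 0 :=
        DifferentiableAt.comp (g := fun x : Cn (N+1) => (x (Fin.last N)).re * (x (Fin.last N)).im) 0 (hc.differentiable (by simp) _) hl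
      have := hd.hasDerivAt.fun_pow 2
      convert! this using 1
      simp [hx]
    convert! hphi.fun_mul hb1.hasDerivAt using 1
    simp [phi, hx]
  simpa [rho] using h1.fun_add h2

lemma wirtD_castSucc {S : Finset (Fin (N+1) × Bool →₀ ℕ)} (p e : Cn N) (β : S → ℝ) (x : Cn (N+1))
    (hx : (x (Fin.last N)).re * (x (Fin.last N)).im = 0) (k : Fin N) :
    wirtD (rho p e β) x k.castSucc = (starRingEnd ℂ) (psi p e k x) +
      (∑ j, (starRingEnd ℂ) (psi p e j x) * p j) * (2 * (starRingEnd ℂ) (x (Fin.last N)) * (starRingEnd ℂ) (e k) * hfun e x) := by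
  have hv : ∀ c : ℂ, fderiv ℝ (rho p e β) x (cbasis k.castSucc c) = 2 * (c * ((starRingEnd ℂ) (psi p e k x) +
      (∑ j, (starRingEnd ℂ) (psi p e j x) * p j) * (2 * (starRingEnd ℂ) (x (Fin.last N)) * (starRingEnd ℂ) (e k) * hfun e x))).re := by
    intro c
    rw [rho_line p e β x _ hx, ← Finset.mul_sum, ← Complex.re_sum]
    congr 2
    have h1 : hfun e (cbasis k.castSucc c) = (starRingEnd ℂ) (e k) * c := by
      simp [hfun, cbasis, Pi.single_apply]
    have h2 : (cbasis k.castSucc c : Cn (N+1)) (Fin.last N) = 0 := by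
      simp [cbasis, Pi.single_apply]
    have h3 : ∀ j : Fin N, (cbasis k.castSucc c : Cn (N+1)) j.castSucc = if j = k then c else 0 := by
      intro j; simp [cbasis, Pi.single_apply]
    simp only [h1, h2, h3, mul_add, Finset.sum_add_distrib, Finset.sum_mul, Finset.mul_sum]
    congr 1
    · simp; ring
    · refine Finset.sum_congr rfl fun j _ => ?_
      simp; ring
  simp only [wirtD, hv]
  apply Complex.ext <;> simp

lemma wirtD_last {S : Finset (Fin (N+1) × Bool →₀ ℕ)} (p e : Cn N) (β : S → ℝ) (x : Cn (N+1))
    (hx : (x (Fin.last N)).re * (x (Fin.last N)).im = 0) :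
    wirtD (rho p e β) x (Fin.last N) = (starRingEnd ℂ) (hfun e x) ^ 2 * ∑ j, psi p e j x * (starRingEnd ℂ) (p j) := by
  have hv : ∀ c : ℂ, fderiv ℝ (rho p e β) x (cbasis (Fin.last N) c) = 2 * (c * ((starRingEnd ℂ) (hfun e x) ^ 2 * ∑ j, psi p e j x * (starRingEnd ℂ) (p j))).re := by
    intro c
    rw [rho_line p e β x _ hx, ← Finset.mul_sum, ← Complex.re_sum]
    rw [← Complex.conj_re]
    congr 2
    have h1 : hfun e (cbasis (Fin.last N) c) = 0 := by
      simp [hfun, cbasis, Pi.single_apply]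
    have h2 : (cbasis (Fin.last N) c : Cn (N+1)) (Fin.last N) = c := by
      simp [cbasis]
    have h3 : ∀ j : Fin N, (cbasis (Fin.last N) c : Cn (N+1)) j.castSucc = 0 := by
      intro j; simp [cbasis, Pi.single_apply]
    simp only [h1, h2, h3, Finset.mul_sum, map_sum]
    refine Finset.sum_congr rfl fun j _ => ?_
    simp; ring
  simp only [wirtD, hv]
  apply Complex.ext <;> simp

end

/- part Memb -/
noncomputable section
open Metric Asymptotics Filter Topology
open scoped ContDiff

variable {N : ℕ}

lemma wirtDBar_add {g h : Cn N → ℂ} {z : Cn N} (hg : DifferentiableAt ℝ g z) (hh : DifferentiableAt ℝ h z) (j) :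
    wirtDBar (fun z => g z + h z) z j = wirtDBar g z j + wirtDBar h z j := by
  simp only [wirtDBar]
  rw [fderiv_fun_add hg hh]
  simp; ring

lemma wirtDBar_mul {g h : Cn N → ℂ} {z : Cn N} (hg : DifferentiableAt ℝ g z) (hh : DifferentiableAt ℝ h z) (j) :
    wirtDBar (fun z => g z * h z) z j = wirtDBar g z j * h z + g z * wirtDBar h z j := by
  simp only [wirtDBar]
  rw [fderiv_fun_mul hg hh]
  simp; ring

/-- antilinear forms -/
def lf (a : Fin N → ℂ) (z : Cn N) : ℂ := ∑ k, a k * (starRingEnd ℂ) (z k)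

/-- linear forms -/
def hf (a : Fin N → ℂ) (z : Cn N) : ℂ := ∑ k, a k * z k

lemma hf_contDiffC (a : Fin N → ℂ) {n} : ContDiff ℂ n (hf a) := by
  unfold hf
  refine ContDiff.sum fun k _ => contDiff_const.mul ?_
  exact (EuclideanSpace.proj k : Cn N →L[ℂ] ℂ).contDiff

lemma hf_contDiff (a : Fin N → ℂ) {n} : ContDiff ℝ n (hf a) := (hf_contDiffC a).restrict_scalars ℝ

lemma lf_contDiff (a : Fin N → ℂ) {n} : ContDiff ℝ n (lf a) := by
  unfold lf
  refine ContDiff.sum fun k _ => contDiff_const.mul ?_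
  exact Complex.conjCLE.contDiff.comp ((EuclideanSpace.proj k : Cn N →L[ℂ] ℂ).restrictScalars ℝ).contDiff

lemma lf_diff (a : Fin N → ℂ) (z) : DifferentiableAt ℝ (lf a) z := (lf_contDiff a (n := 1)).differentiable (by simp) z
lemma hf_diff (a : Fin N → ℂ) (z) : DifferentiableAt ℂ (hf a) z := (hf_contDiffC a (n := 1)).differentiable (by simp) z

lemma lf_line (a : Fin N → ℂ) (z v : Cn N) : fderiv ℝ (lf a) z v = lf a v := by
  have hl : IsLinearMap ℝ (lf a) := by
    constructor
    · intro x y; simp [lf, mul_add, Finset.sum_add_distrib]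
    · intro c x; simp only [lf, Finset.smul_sum]; exact Finset.sum_congr rfl fun k _ => by simp; ring
  have : fderiv ℝ (LinearMap.toContinuousLinearMap hl.mk') z = LinearMap.toContinuousLinearMap hl.mk' :=
    ContinuousLinearMap.fderiv _
  have h2 : fderiv ℝ (lf a) z = LinearMap.toContinuousLinearMap hl.mk' := this
  rw [h2]; rfl

lemma wirtDBar_lf (a : Fin N → ℂ) (z : Cn N) (j) : wirtDBar (lf a) z j = a j := by
  simp only [wirtDBar, lf_line]
  have : ∀ c, lf a (cbasis j c) = a j * (starRingEnd ℂ) c := by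
    intro c
    simp only [lf, cbasis, PiLp.single_apply]
    rw [Finset.sum_eq_single j]
    · simp
    · intro b _ hb; simp [hb]
    · simp
  rw [this, this]
  simp only [map_one, Complex.conj_I]
  linear_combination (-(1/2 : ℂ) * a j) * Complex.I_mul_I

/-- CR fields of the sphere -/
def crf {M : Set (Cn N)} (hM : M = {z : Cn N | ‖z‖ = 1}) (p : Cn N) (u : Fin N → ℂ) : CRVectorField M p where
  coeff := fun z j => hf (fun k => (starRingEnd ℂ) (p k)) z * u j - hf u z * (starRingEnd ℂ) (p j)
  dom := Set.univ
  isOpen := isOpen_univ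
  mem := trivial
  analytic := by
    intro j
    apply contDiff_omega_iff_analyticOnNhd.mp
    exact ((hf_contDiff _).mul contDiff_const).sub ((hf_contDiff _).mul contDiff_const)
  tangent := by
    intro f U hU hpU hf1 hf0
    refine ⟨U, hU, hpU, ?_⟩
    rintro z ⟨hzM, hzU⟩
    have hz : ‖z‖ = 1 := by rw [hM] at hzM; exact hzM
    have hk := normal_form (fderiv ℝ f z) z hz (fun v hv => kills_tangent f z hz (hf1 z hzU).differentiableAt (by
      filter_upwards [hU.mem_nhds hzU] with x hx hx1
      exact hf0 x ⟨by rw [hM]; exact hx1, hx⟩) v hv)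
    have hw : ∀ j, wirtDBarR f z j = ((fderiv ℝ f z z : ℝ) : ℂ) / 2 * z j := by
      intro j
      simp only [wirtDBarR]
      rw [hk (cbasis j 1), hk (cbasis j Complex.I), inner_cbasis, inner_cbasis]
      simp
      conv_rhs => rw [← Complex.re_add_im (z j)]
      ring
    simp only [hw]
    have : ∀ j, (hf (fun k => (starRingEnd ℂ) (p k)) z * u j - hf u z * (starRingEnd ℂ) (p j)) * (((fderiv ℝ f z z : ℝ) : ℂ) / 2 * z j)
      = ((fderiv ℝ f z z : ℝ) : ℂ) / 2 * (hf (fun k => (starRingEnd ℂ) (p k)) z * (u j * z j) - hf u z * ((starRingEnd ℂ) (p j) * z j)) := by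
      intro j; ring
    rw [Finset.sum_congr rfl fun j _ => this j, ← Finset.mul_sum, Finset.sum_sub_distrib, ← Finset.mul_sum, ← Finset.mul_sum]
    simp only [hf]
    ring

def snocC (z : Cn N) (w : ℂ) : Cn (N+1) := WithLp.toLp 2 (Fin.snoc (α := fun _ => ℂ) z.ofLp w)

@[simp] lemma snocC_castSucc (z : Cn N) (w : ℂ) (j : Fin N) : snocC z w j.castSucc = z j := by
  simp [snocC]
@[simp] lemma snocC_last (z : Cn N) (w : ℂ) : snocC z w (Fin.last N) = w := by
  simp [snocC]

def Hm (p e : Cn N) (w0 : ℂ) (z : Cn N) : Cn (N+1) :=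
  snocC (z - ((starRingEnd ℂ) w0 * hf (fun k => (starRingEnd ℂ) (e k)) z ^ 2) • p) w0

lemma Hm_diff (p e : Cn N) (w0 : ℂ) : Differentiable ℂ (Hm p e w0) := by
  rw [differentiable_euclidean]
  intro i
  refine Fin.lastCases ?_ (fun k => ?_) i
  · simp [Hm]
  · simp only [Hm, snocC_castSucc]
    have h1 : Differentiable ℂ fun z : Cn N => z k := differentiable_euclidean.mp differentiable_id k
    have h2 : Differentiable ℂ (hf (N := N) (fun k => (starRingEnd ℂ) (e k))) := fun z => hf_diff _ z
    have : (fun x : Cn N => (x - ((starRingEnd ℂ) w0 * hf (fun k => (starRingEnd ℂ) (e k)) x ^ 2) • p) k) =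
      fun x => x k - ((starRingEnd ℂ) w0 * hf (fun k => (starRingEnd ℂ) (e k)) x ^ 2) * p k := by
      funext x; simp
    rw [this]
    exact h1.sub (((h2.pow 2).const_mul _).mul_const _)

lemma hfun_Hm (p e : Cn N) (w0 : ℂ) (hpe : ∑ k, (starRingEnd ℂ) (e k) * p k = 0) (z) :
    hfun e (Hm p e w0 z) = hf (fun k => (starRingEnd ℂ) (e k)) z := by
  simp only [hfun, Hm, snocC_castSucc]
  have : ∀ k, (starRingEnd ℂ) (e k) * (z - ((starRingEnd ℂ) w0 * hf (fun k => (starRingEnd ℂ) (e k)) z ^ 2) • p) k =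
    (starRingEnd ℂ) (e k) * z k - ((starRingEnd ℂ) w0 * hf (fun k => (starRingEnd ℂ) (e k)) z ^ 2) * ((starRingEnd ℂ) (e k) * p k) := by
    intro k; simp; ring
  rw [Finset.sum_congr rfl fun k _ => this k, Finset.sum_sub_distrib, ← Finset.mul_sum, hpe]
  simp [hf]

lemma psi_Hm (p e : Cn N) (w0 : ℂ) (hpe : ∑ k, (starRingEnd ℂ) (e k) * p k = 0) (z) (j) :
    psi p e j (Hm p e w0 z) = z j := by
  rw [psi, hfun_Hm p e w0 hpe]
  simp [Hm]

lemma Hm_p (p e : Cn N) (w0 : ℂ) (hpe : ∑ k, (starRingEnd ℂ) (e k) * p k = 0) : Hm p e w0 p = snocC p w0 := by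
  simp [Hm, hf, hpe]

lemma rho_Hm {S : Finset (Fin (N+1) × Bool →₀ ℕ)} (p e : Cn N) (β : S → ℝ) (w0 : ℂ) (hw : w0.re * w0.im = 0)
    (hpe : ∑ k, (starRingEnd ℂ) (e k) * p k = 0) (z) : rho p e β (Hm p e w0 z) = ‖z‖ ^ 2 - 1 := by
  have h : phi (Hm p e w0 z) = 0 := by simp [phi, Hm, hw]
  simp only [rho, h, rho0, psi_Hm p e w0 hpe]
  rw [EuclideanSpace.norm_sq_eq]; simp


lemma G_castSucc {S : Finset (Fin (N+1) × Bool →₀ ℕ)} (p e : Cn N) (β : S → ℝ) (w0 : ℂ) (hw : w0.re * w0.im = 0)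
    (hpe : ∑ k, (starRingEnd ℂ) (e k) * p k = 0) (k : Fin N) : (fun z => wirtD (rho p e β) (Hm p e w0 z) k.castSucc) =
    fun z => lf (Pi.single k 1) z + lf p.ofLp z * (2 * (starRingEnd ℂ) w0 * (starRingEnd ℂ) (e k) * hf (fun k => (starRingEnd ℂ) (e k)) z) := by
  funext z
  rw [wirtD_castSucc p e β _ (by simp [Hm, hw])]
  simp only [psi_Hm p e w0 hpe, hfun_Hm p e w0 hpe]
  congr 1
  · simp [lf, Pi.single_apply]
  · congr 1
    · exact Finset.sum_congr rfl fun j _ => by ring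
    · simp [Hm]

lemma G_last {S : Finset (Fin (N+1) × Bool →₀ ℕ)} (p e : Cn N) (β : S → ℝ) (w0 : ℂ) (hw : w0.re * w0.im = 0)
    (hpe : ∑ k, (starRingEnd ℂ) (e k) * p k = 0) : (fun z => wirtD (rho p e β) (Hm p e w0 z) (Fin.last N)) =
    fun z => (lf e.ofLp z * lf e.ofLp z) * hf (fun k => (starRingEnd ℂ) (p k)) z := by
  funext z
  rw [wirtD_last p e β _ (by simp [Hm, hw])]
  simp only [psi_Hm p e w0 hpe, hfun_Hm p e w0 hpe]
  congr 1
  · rw [← pow_two]; congr 1; simp [lf, hf]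
  · exact Finset.sum_congr rfl fun j _ => by ring


lemma apply_last {M : Set (Cn N)} (hM : M = {z : Cn N | ‖z‖ = 1}) (p e : Cn N) (u : Fin N → ℂ) (z : Cn N) :
    (crf hM p u).apply (fun z => (lf e.ofLp z * lf e.ofLp z) * hf (fun k => (starRingEnd ℂ) (p k)) z) z =
      2 * lf e.ofLp z * hf (fun k => (starRingEnd ℂ) (p k)) z * ∑ j, (crf hM p u).coeff z j * e j := by
  simp only [CRVectorField.apply, Finset.mul_sum]
  refine Finset.sum_congr rfl fun j _ => ?_
  rw [wirtDBar_mul_holo ((lf_diff _ z).fun_mul (lf_diff _ z)) (hf_diff _ z), wirtDBar_mul (lf_diff _ z) (lf_diff _ z), wirtDBar_lf]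
  ring

lemma coeff_e {M : Set (Cn N)} (hM : M = {z : Cn N | ‖z‖ = 1}) (p e : Cn N) 
    (hpe : ∑ k, (starRingEnd ℂ) (p k) * e k = 0) (hee : ∑ k, (starRingEnd ℂ) (e k) * e k = 1) (z : Cn N) :
    ∑ j, (crf hM p (fun k => (starRingEnd ℂ) (e k))).coeff z j * e j = hf (fun k => (starRingEnd ℂ) (p k)) z := by
  simp only [crf, sub_mul, Finset.sum_sub_distrib, mul_assoc, ← Finset.mul_sum, hpe, hee]
  ring

lemma apply2_last {M : Set (Cn N)} (hM : M = {z : Cn N | ‖z‖ = 1}) (p e : Cn N) 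
    (hpe : ∑ k, (starRingEnd ℂ) (p k) * e k = 0) (hee : ∑ k, (starRingEnd ℂ) (e k) * e k = 1) (z : Cn N) :
    (crf hM p (fun k => (starRingEnd ℂ) (e k))).apply ((crf hM p (fun k => (starRingEnd ℂ) (e k))).apply
      (fun z => (lf e.ofLp z * lf e.ofLp z) * hf (fun k => (starRingEnd ℂ) (p k)) z)) z =
      2 * hf (fun k => (starRingEnd ℂ) (p k)) z ^ 3 := by
  have h1 : (crf hM p (fun k => (starRingEnd ℂ) (e k))).apply
      (fun z => (lf e.ofLp z * lf e.ofLp z) * hf (fun k => (starRingEnd ℂ) (p k)) z) =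
      fun z => lf e.ofLp z * (2 * hf (fun k => (starRingEnd ℂ) (p k)) z ^ 2) := by
    funext z
    rw [apply_last, coeff_e hM p e hpe hee]; ring
  rw [h1, CRVectorField.apply]
  have h2 : ∀ j, wirtDBar (fun z => lf e.ofLp z * (2 * hf (fun k => (starRingEnd ℂ) (p k)) z ^ 2)) z j = e j * (2 * hf (fun k => (starRingEnd ℂ) (p k)) z ^ 2) := by
    intro j
    rw [wirtDBar_mul_holo (lf_diff _ z) (((hf_diff _ z).fun_pow 2).const_mul 2), wirtDBar_lf]
  simp only [h2]
  simp only [← mul_assoc, ← Finset.sum_mul]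
  rw [coeff_e hM p e hpe hee]; ring

lemma apply_castSucc {M : Set (Cn N)} (hM : M = {z : Cn N | ‖z‖ = 1}) (p e : Cn N) (w0 : ℂ) (hp : ‖p‖ = 1)
    (hpe : ∑ k, (starRingEnd ℂ) (e k) * p k = 0) (u : Fin N → ℂ) (hu : hf u p = 0) (k : Fin N) :
    (crf hM p u).apply (fun z => lf (Pi.single k 1) z + lf p.ofLp z * (2 * (starRingEnd ℂ) w0 * (starRingEnd ℂ) (e k) * hf (fun k => (starRingEnd ℂ) (e k)) z)) p = u k := by
  have hpp : hf (fun k => (starRingEnd ℂ) (p k)) p = 1 := by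
    have h := EuclideanSpace.norm_sq_eq p
    rw [hp] at h
    have h2 : ∀ k, (starRingEnd ℂ) (p k) * p k = ((‖p k‖ ^ 2 : ℝ) : ℂ) := by
      intro k; rw [Complex.conj_mul']; simp
    simp only [hf, h2]
    rw [← Complex.ofReal_sum, ← h]; simp
  have h2 : ∀ j, wirtDBar (fun z => lf (Pi.single k 1) z + lf p.ofLp z * (2 * (starRingEnd ℂ) w0 * (starRingEnd ℂ) (e k) * hf (fun k => (starRingEnd ℂ) (e k)) z)) p j = (Pi.single k 1 : Fin N → ℂ) j := by
    intro j
    have hd := (hf_diff (fun k => (starRingEnd ℂ) (e k)) p).const_mul (2 * (starRingEnd ℂ) w0 * (starRingEnd ℂ) (e k))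
    rw [wirtDBar_add (lf_diff _ p) ((lf_diff _ p).fun_mul (hd.restrictScalars ℝ)), wirtDBar_mul_holo (lf_diff _ p) hd, wirtDBar_lf]
    simp only [hf, hpe]; simp
  simp only [CRVectorField.apply, h2, crf, hu, hpp]
  simp [Pi.single_apply]

lemma memb {M : Set (Cn N)} (hM : M = {z : Cn N | ‖z‖ = 1}) {p : Cn N} (hp : p ∈ M) (e : Cn N) (he : ‖e‖ = 1)
    (hpe : inner ℂ p e = 0) {S : Finset (Fin (N+1) × Bool →₀ ℕ)} (β : S → ℝ) (w0 : ℂ) (hw : w0.re * w0.im = 0)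
    (ℓ : ℕ) (hℓ : 2 ≤ ℓ) : snocC p w0 ∈ MappingLocus M p (Mp (rho p e β)) ℓ := by
  have hp1 : ‖p‖ = 1 := by rw [hM] at hp; exact hp
  have sumsq : ∀ x : Cn N, ‖x‖ = 1 → ∑ k, (starRingEnd ℂ) (x k) * x k = 1 := by
    intro x hx
    have h := EuclideanSpace.norm_sq_eq x
    rw [hx] at h
    have h2 : ∀ k, (starRingEnd ℂ) (x k) * x k = ((‖x k‖ ^ 2 : ℝ) : ℂ) := by
      intro k; rw [Complex.conj_mul']; simp
    simp only [h2]
    rw [← Complex.ofReal_sum, ← h]; simp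
  have hpe1 : ∑ k, (starRingEnd ℂ) (p k) * e k = 0 := by
    rw [← hpe, PiLp.inner_apply]; exact Finset.sum_congr rfl fun k _ => by simp [mul_comm]
  have hpe2 : ∑ k, (starRingEnd ℂ) (e k) * p k = 0 := by
    have := congrArg (starRingEnd ℂ) hpe1
    simpa [map_sum, mul_comm] using this
  have hee := sumsq e he
  have hpp := sumsq p hp1
  have hlp : lf e.ofLp p = 0 := by simp only [lf]; rw [← hpe1]; exact Finset.sum_congr rfl fun k _ => mul_comm _ _
  have hGp : ∀ k : Fin N, wirtD (rho p e β) (Hm p e w0 p) k.castSucc = (starRingEnd ℂ) (p k) := by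
    intro k
    rw [congrFun (G_castSucc p e β w0 hw hpe2 k) p]
    have : hf (fun k => (starRingEnd ℂ) (e k)) p = 0 := hpe2
    rw [this]; simp [lf, Pi.single_apply]
  have hGpl : wirtD (rho p e β) (Hm p e w0 p) (Fin.last N) = 0 := by
    rw [congrFun (G_last p e β w0 hw hpe2) p, hlp]; simp
  have hne : wirtD (rho p e β) (Hm p e w0 p) ≠ 0 := by
    intro h
    have : ∀ k, (starRingEnd ℂ) (p k) = 0 := fun k => by rw [← hGp k, h]; rfl
    simp [this] at hpp
  have hΩ : IsOpen {z | wirtD (rho p e β) (Hm p e w0 z) ≠ 0} :=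
    isOpen_ne_fun ((wirtD_continuous (rho_contDiff p e β)).comp (Hm_diff p e w0).continuous) continuous_const
  have hmem : ∀ z ∈ M ∩ {z | wirtD (rho p e β) (Hm p e w0 z) ≠ 0}, Hm p e w0 z ∈ Mp (rho p e β) := by
    rintro z ⟨hz, hz2⟩
    refine ⟨hz2, ?_⟩
    rw [rho_Hm p e β w0 hw hpe2]
    have : ‖z‖ = 1 := by rw [hM] at hz; exact hz
    simp [this]
  refine ⟨Hm_p p e w0 hpe2 ▸ hmem p ⟨hp, hne⟩, _, Hm p e w0, hΩ, hne, (Hm_diff p e w0).differentiableOn, Hm_p p e w0 hpe2, hmem, ?_⟩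
  unfold FinNondeg
  set T := Submodule.span ℂ
    { v : Fin (N+1) → ℂ | ∃ (Ls : List (CRVectorField M p)) (ρ' : Cn (N+1) → ℝ) (U' : Set (Cn (N+1))),
        Ls.length ≤ ℓ ∧ IsOpen U' ∧ Hm p e w0 p ∈ U' ∧ AnalyticOnNhd ℝ ρ' U' ∧
        (∀ w ∈ Mp (rho p e β) ∩ U', ρ' w = 0) ∧
        v = fun j => CRApplyList Ls (fun z => wirtD ρ' (Hm p e w0 z) j) p } with hT
  have key : ∀ Ls : List (CRVectorField M p), Ls.length ≤ ℓ →
      (fun j => CRApplyList Ls (fun z => wirtD (rho p e β) (Hm p e w0 z) j) p) ∈ T := by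
    intro Ls hl
    exact Submodule.subset_span ⟨Ls, rho p e β, Set.univ, hl, isOpen_univ, trivial,
      contDiff_omega_iff_analyticOnNhd.mp (rho_contDiff p e β), fun w hw => hw.1.2, rfl⟩
  have k0 : (Fin.snoc (α := fun _ => ℂ) (fun k => (starRingEnd ℂ) (p k)) 0 : Fin (N+1) → ℂ) ∈ T := by
    convert key [] (by simp) using 1
    funext j
    refine Fin.lastCases ?_ (fun k => ?_) j
    · simp [CRApplyList, hGpl]
    · simp [CRApplyList, hGp]
  have k1 : ∀ u : Fin N → ℂ, hf u p = 0 → (Fin.snoc (α := fun _ => ℂ) u 0 : Fin (N+1) → ℂ) ∈ T := by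
    intro u hu
    convert key [crf hM p u] (by simp; omega) using 1
    funext j
    refine Fin.lastCases ?_ (fun k => ?_) j
    · simp only [CRApplyList, List.foldr, G_last p e β w0 hw hpe2]
      rw [apply_last, hlp]; simp
    · simp only [CRApplyList, List.foldr, G_castSucc p e β w0 hw hpe2]
      rw [apply_castSucc hM p e w0 hp1 hpe2 u hu]; simp
  have k2 : ∀ v : Fin (N+1) → ℂ, v (Fin.last N) = 0 → v ∈ T := by
    intro v hv
    set a : ℂ := ∑ k, v k.castSucc * p k with ha
    have : v = a • (Fin.snoc (α := fun _ => ℂ) (fun k => (starRingEnd ℂ) (p k)) 0 : Fin (N+1) → ℂ) +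
      (Fin.snoc (α := fun _ => ℂ) (fun k => v k.castSucc - a * (starRingEnd ℂ) (p k)) 0 : Fin (N+1) → ℂ) := by
      funext j
      refine Fin.lastCases ?_ (fun k => ?_) j
      · simp [hv]
      · simp
    rw [this]
    refine T.add_mem (T.smul_mem _ k0) (k1 _ ?_)
    simp only [hf, sub_mul, Finset.sum_sub_distrib, mul_assoc, ← Finset.mul_sum, hpp]
    rw [← ha]; ring
  rw [eq_top_iff]
  intro v _
  have h2 := key [crf hM p (fun k => (starRingEnd ℂ) (e k)), crf hM p (fun k => (starRingEnd ℂ) (e k))] (by simpa using hℓ)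
  set t := (fun j => CRApplyList [crf hM p (fun k => (starRingEnd ℂ) (e k)), crf hM p (fun k => (starRingEnd ℂ) (e k))] (fun z => wirtD (rho p e β) (Hm p e w0 z) j) p) with ht
  have htl : t (Fin.last N) = 2 := by
    simp only [ht, CRApplyList, List.foldr, G_last p e β w0 hw hpe2]
    rw [apply2_last hM p e hpe1 hee]
    have : hf (fun k => (starRingEnd ℂ) (p k)) p = 1 := hpp
    rw [this]; simp
  have : v = (v (Fin.last N) / 2) • t + (v - (v (Fin.last N) / 2) • t) := by abel
  rw [this]
  refine T.add_mem (T.smul_mem _ h2) (k2 _ ?_)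
  simp [htl]

end
noncomputable section
open Metric Asymptotics Filter Topology
open scoped ContDiff

variable {N : ℕ}

lemma curve_exists {E : Type*} [NormedAddCommGroup E] [NormedSpace ℝ E] [CompleteSpace E] {c : ℕ}
    (ρ : E → Fin c → ℝ) (q : E) (hρ : ∀ k, AnalyticAt ℝ (fun z => ρ z k) q)
    (hind : LinearIndependent ℝ (fun k : Fin c => fderiv ℝ (fun z => ρ z k) q)) (h0 : ∀ k, ρ q k = 0)
    (v : E) (hv : ∀ k, fderiv ℝ (fun z => ρ z k) q v = 0) :
    ∃ γ : ℝ → E, γ 0 = q ∧ HasDerivAt γ v 0 ∧ ∀ᶠ t in 𝓝 (0:ℝ), ∀ k, ρ (γ t) k = 0 := by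
  set f' : E →L[ℝ] (Fin c → ℝ) := ContinuousLinearMap.pi fun k => fderiv ℝ (fun z => ρ z k) q with hf'
  have hs : HasStrictFDerivAt ρ f' q := hasStrictFDerivAt_pi.2 fun k => (hρ k).hasStrictFDerivAt
  have hr : f'.range = ⊤ := by
    by_contra hne
    obtain ⟨Λ, hΛ, hle⟩ := Submodule.exists_le_ker_of_lt_top _ (lt_top_iff_ne_top.mpr hne)
    apply hΛ
    have hrel : ∑ k, Λ (Pi.single k 1) • fderiv ℝ (fun z => ρ z k) q = 0 := by
      ext x
      have h1 : Λ (f' x) = 0 := hle ⟨x, rfl⟩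
      rw [← LinearMap.sum_single_apply (fun _ => ℝ) (f' x), map_sum] at h1
      simp only [sum_apply, smul_apply, zero_apply]
      rw [← h1]
      refine Finset.sum_congr rfl fun k _ => ?_
      have : (Pi.single k (f' x k) : Fin c → ℝ) = (f' x k) • Pi.single k 1 := by
        rw [← Pi.single_smul]; simp
      rw [this, map_smul, smul_eq_mul, smul_eq_mul, mul_comm]; rfl
    have hz := Fintype.linearIndependent_iff.mp hind _ hrel
    apply LinearMap.pi_ext'
    intro k
    ext
    simpa using hz k
  have hvk : v ∈ f'.ker := by
    rw [LinearMap.mem_ker]; funext k; exact hv k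
  let g := hs.implicitFunction ρ f' hr (ρ q)
  have hg : HasStrictFDerivAt g f'.ker.subtypeL 0 := hs.to_implicitFunction hr
  have hl : HasDerivAt (fun t : ℝ => t • (⟨v, hvk⟩ : f'.ker)) ⟨v, hvk⟩ 0 := by
    simpa using (hasDerivAt_id (0:ℝ)).smul_const (⟨v, hvk⟩ : f'.ker)
  refine ⟨fun t => g (t • ⟨v, hvk⟩), ?_, ?_, ?_⟩
  · simp only [zero_smul]
    exact tendsto_nhds_unique tendsto_const_nhds (hs.tendsto_implicitFunction hr (l := pure ()) (g₁ := fun _ => ρ q) (g₂ := fun _ => 0) tendsto_const_nhds tendsto_const_nhds)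
  · have h2 : HasFDerivAt g f'.ker.subtypeL ((0:ℝ) • (⟨v, hvk⟩ : f'.ker)) := by
      rw [zero_smul]; exact hg.hasFDerivAt
    exact h2.comp_hasDerivAt 0 hl
  · have h3 := hs.map_implicitFunction_eq hr
    have h4 : Tendsto (fun t : ℝ => (ρ q, t • (⟨v, hvk⟩ : f'.ker))) (𝓝 0) (𝓝 (ρ q, 0)) := by
      refine tendsto_const_nhds.prodMk_nhds ?_
      simpa using hl.continuousAt.tendsto
    filter_upwards [h4.eventually h3] with t ht k
    have := congrFun ht k
    rw [← h0 k]; exact this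

lemma snocC_line (p : Cn N) (c : ℂ) (t : ℝ) : snocC p 0 + t • cbasis (Fin.last N) c = snocC p (t * c) := by
  ext j
  refine Fin.lastCases ?_ (fun k => ?_) j
  · simp [cbasis]
  · simp [cbasis]

lemma not_sub (E U : Set (Cn (N+1))) (p : Cn N) (hU : IsOpen U) (hq : snocC p 0 ∈ U)
    (h1 : ∀ w : ℂ, w.re * w.im = 0 → snocC p w ∈ E) (h2 : ∀ x ∈ E, phi x = 0) : ¬ IsRASubmanifold (E ∩ U) := by
  intro hsub
  have hqE : snocC p 0 ∈ E ∩ U := ⟨h1 0 (by simp), hq⟩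
  obtain ⟨mdim, c, V, ρ, hV, hqV, -, han, hset, hind⟩ := hsub _ hqE
  have hcont : ∀ v : Cn (N+1), ContinuousAt (fun t : ℝ => snocC p 0 + t • v) 0 := by
    intro v; fun_prop
  have hkey : ∀ k, ∀ d : ℂ, d.re * d.im = 0 → fderiv ℝ (fun z => ρ z k) (snocC p 0) (cbasis (Fin.last N) d) = 0 := by
    intro k d hd
    apply fderiv_line (han k _ hqV).differentiableAt
    apply (hasDerivAt_const (0:ℝ) (0:ℝ)).congr_of_eventuallyEq
    have := (hcont (cbasis (Fin.last N) d)).eventually_mem (s := U ∩ V) (by simpa using (hU.inter hV).mem_nhds ⟨hq, hqV⟩)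
    filter_upwards [this] with t ht
    have hmem : snocC p 0 + t • cbasis (Fin.last N) d ∈ E ∩ U ∩ V := by
      refine ⟨⟨?_, ht.1⟩, ht.2⟩
      rw [snocC_line]
      apply h1
      simp only [Complex.re_ofReal_mul, Complex.im_ofReal_mul]
      linear_combination t * t * hd
    rw [hset] at hmem
    exact hmem.2 k
  have hq0 : snocC p 0 ∈ E ∩ U ∩ V := ⟨hqE, hqV⟩
  have hadd : (cbasis (Fin.last N) (1 + Complex.I) : Cn (N+1)) = cbasis (Fin.last N) 1 + cbasis (Fin.last N) Complex.I := by
    ext j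
    by_cases h : j = Fin.last N <;> simp [cbasis, h]
  obtain ⟨γ, hγ0, hγd, hγ⟩ := curve_exists ρ (snocC p 0) (fun k => han k _ hqV) (hind _ hq0)
    (by have := hq0; rw [hset] at this; exact this.2) (cbasis (Fin.last N) (1 + Complex.I)) (by
      intro k
      rw [hadd, map_add, hkey k 1 (by simp), hkey k Complex.I (by simp), add_zero])
  have hl : HasDerivAt (fun t => (γ t) (Fin.last N)) (1 + Complex.I) 0 := by
    have := ((EuclideanSpace.proj (Fin.last N) : Cn (N+1) →L[ℂ] ℂ).restrictScalars ℝ).hasFDerivAt.comp_hasDerivAt (0:ℝ) hγd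
    simpa [cbasis, Function.comp_def] using this
  have hre : HasDerivAt (fun t => ((γ t) (Fin.last N)).re) 1 0 := by
    simpa [Function.comp_def] using Complex.reCLM.hasFDerivAt.comp_hasDerivAt (0:ℝ) hl
  have him : HasDerivAt (fun t => ((γ t) (Fin.last N)).im) 1 0 := by
    simpa [Function.comp_def] using Complex.imCLM.hasFDerivAt.comp_hasDerivAt (0:ℝ) hl
  have hVe : ∀ᶠ t in 𝓝 (0:ℝ), γ t ∈ V := hγd.continuousAt.eventually_mem (by rw [hγ0]; exact hV.mem_nhds hqV)
  have hall := ((hre.eventually_ne (c := 0) one_ne_zero).and (him.eventually_ne (c := 0) one_ne_zero)).and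
    ((hVe.and hγ).filter_mono nhdsWithin_le_nhds)
  obtain ⟨t, ⟨ht1, ht2⟩, ht3, ht4⟩ := hall.exists
  have hm : γ t ∈ E ∩ U ∩ V := by rw [hset]; exact ⟨ht3, ht4⟩
  have := h2 _ hm.1.1
  simp [phi, ht1, ht2] at this

end

/-- **Theorem 1.2.** Let `M` be the unit sphere in `ℂ^N` (`N ≥ 2`) with base point `p`.
Then there is a real hypersurface `M' ⊆ ℂ^{N+1}` (a generic real-analytic submanifold of
codimension `1`) such that for every `ℓ ≥ 2` the mapping locus `E_ℓ ⊆ M'` is singular: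
there is a point `q ∈ E_ℓ` near which `E_ℓ` is not a real-analytic submanifold. -/
theorem exists_target_with_singular_mapping_locus
    {N : ℕ} (hN : 2 ≤ N) (M : Set (Cn N)) (hM : M = {z : Cn N | ‖z‖ = 1})
    (p : Cn N) (hp : p ∈ M) :
    ∃ M' : Set (Cn (N + 1)),
      (∀ q ∈ M', IsGenericAt M' 1 q) ∧
      ∀ ℓ : ℕ, 2 ≤ ℓ →
        ∃ q ∈ MappingLocus M p M' ℓ,
          ∀ U : Set (Cn (N + 1)), IsOpen U → q ∈ U →
            ¬ IsRASubmanifold (MappingLocus M p M' ℓ ∩ U) := by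
  obtain ⟨e, he, hpe⟩ := exists_orth hN p
  let r : ℕ := 18 * N + 40
  have hr : 2 * ((N+1)*((3*r+1)*(3*r+1)) + (N + N)) < (r+1)^3 := by
    simp only [r]; ring_nf; nlinarith [sq_nonneg N, Nat.zero_le (N^3)]
  let S : Finset (Fin (N+1) × Bool →₀ ℕ) := (Finsupp.finite_of_degree_le (3 * r)).toFinset
  have hS : ∀ d : Fin (N+1) × Bool →₀ ℕ, d.degree ≤ 3 * r → d ∈ S := by
    intro d hd; simpa [S] using hd
  obtain ⟨β, hβ⟩ := exists_alg_indep S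
  refine ⟨Mp (rho p e β), fun q hq => Mp_generic (rho_contDiff p e β) q hq, fun ℓ hℓ => ?_⟩
  have hm := fun (w : ℂ) (hw : w.re * w.im = 0) => memb hM hp e he hpe β w hw ℓ hℓ
  refine ⟨snocC p 0, hm 0 (by simp), fun U hU hq => ?_⟩
  exact not_sub _ U p hU hq hm fun x hx => excl hN hM hp e r hr hS β hβ ℓ x hx


end
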